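/- Suppose the initial data U₀ : ℝ → ℝ^r is bounded, measurable, of bounded total variation, vanishes for x > 1, and is in equilibrium: f_i(u_{i0}(x), u_{i+1,0}(x)) = 0 for almost every x and all i. Assume for every v there exists w with v·f_i(v,w) ≥ 0 for all i, and assume Assumption (★). For each ε > 0 let U^ε be the weak solution of ∂_t u_i + λ_i ∂_x u_i = (1/ε)Q_i(U) with initial data U₀ constructed as the limit of the difference scheme, satisfying the uniform bounds |U^ε| ≤ TV(U₀), TV(U^ε(·,t)) ≤ TV(U₀) and ∫|U^ε(·,t) − U^ε(·,t₁)| ≤ C|t−t₁| with C independent of ε. Then there exist a sequence ε_k → 0 and a bounded measurable function U* = (u_1*,…,u_r*) such that U^{ε_k} → U* in L¹_loc(ℝ × (0,∞))^r, and U* is a weak solution of the equilibrium system: f_i(u_i*(x,t), u_{i+1}*(x,t)) = 0 for almost every (x,t) and all i, and for every C¹ compactly supported test function φ : ℝ × [0,∞) → ℝ, ∫₀^∞∫_ℝ ( (∑_i u_i*) ∂_t φ + (∑_i λ_i u_i*) ∂_x φ ) dx dt + ∫_ℝ (∑_i u_{i0}(x)) φ(x,0) dx = 0. Moreover |U*(x,t)|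 ≤ TV(U₀) for almost every (x,t), TV(U*(·,t)) ≤ TV(U₀), and ∫_ℝ |U*(x,t) − U*(x,t₁)| dx ≤ C|t − t₁| for all t, t₁ > 0. -/

import Mathlib

open scoped BigOperators

noncomputable section

/-- The 1-norm `|V| = ∑ i |v_i|` on `ℝ^r`. -/
def onenorm {r : ℕ} (V : Fin r → ℝ) : ℝ := ∑ i, |V i|

/-- The reaction term `Q(U) = (f_1, f_2 - f_1, …, f_i - f_{i-1}, …, -f_{r-1})`
for `U ∈ ℝ^r` with `r = m + 2`, built from `f_i = f_i (u_i, u_{i+1})`. -/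
def Qr (m : ℕ) (f : Fin (m + 1) → ℝ → ℝ → ℝ) (U : Fin (m + 2) → ℝ) :
    Fin (m + 2) → ℝ :=
  fun k =>
    (∑ i : Fin (m + 1), if k = i.castSucc then f i (U i.castSucc) (U i.succ) else 0)
      - ∑ i : Fin (m + 1), if k = i.succ then f i (U i.castSucc) (U i.succ) else 0

/-- The semi-implicit upwind scheme
`(U_j^{n+1} - U_j^n)/Δt + Λ⁺(U_j^n - U_{j-1}^n)/Δx + Λ⁻(U_{j+1}^n - U_j^n)/Δx
  = (1/ε) Q(U_j^{n+1})`,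
where `λ_i^± = (λ_i ± |λ_i|)/2` and `Λ^± = diag(λ_1^±, …, λ_r^±)`. -/
def Scheme (m : ℕ) (f : Fin (m + 1) → ℝ → ℝ → ℝ) (lam : Fin (m + 2) → ℝ)
    (Δt Δx ε : ℝ) (U : ℕ → ℤ → Fin (m + 2) → ℝ) : Prop :=
  ∀ (n : ℕ) (j : ℤ) (i : Fin (m + 2)),
    (U (n + 1) j i - U n j i) / Δt
      + (lam i + |lam i|) / 2 * (U n j i - U n (j - 1) i) / Δx
      + (lam i - |lam i|) / 2 * (U n (j + 1) i - U n j i) / Δx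
    = (1 / ε) * Qr m f (U (n + 1) j) i

/-- The CFL condition `(Δt/Δx) · max_i |λ_i| ≤ 1`. -/
def CFL (m : ℕ) (lam : Fin (m + 2) → ℝ) (Δt Δx : ℝ) : Prop :=
  ∀ i, Δt / Δx * |lam i| ≤ 1

/-- `A_i(V, W) = ∫₀¹ ∂₁f_i(θv_i + (1-θ)w_i, θv_{i+1} + (1-θ)w_{i+1}) dθ`. -/
def Aint (m : ℕ) (f : Fin (m + 1) → ℝ → ℝ → ℝ) (V W : Fin (m + 2) → ℝ)
    (i : Fin (m + 1)) : ℝ :=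
  ∫ θ in (0 : ℝ)..1,
    deriv (fun v => f i v (θ * V i.succ + (1 - θ) * W i.succ))
      (θ * V i.castSucc + (1 - θ) * W i.castSucc)

/-- `B_i(V, W) = ∫₀¹ ∂₂f_i(θv_i + (1-θ)w_i, θv_{i+1} + (1-θ)w_{i+1}) dθ`. -/
def Bint (m : ℕ) (f : Fin (m + 1) → ℝ → ℝ → ℝ) (V W : Fin (m + 2) → ℝ)
    (i : Fin (m + 1)) : ℝ :=
  ∫ θ in (0 : ℝ)..1,
    deriv (fun w => f i (θ * V i.castSucc + (1 - θ) * W i.castSucc) w)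
      (θ * V i.succ + (1 - θ) * W i.succ)

/-- The `(r-1) × (r-1)` tridiagonal matrix `M(V, W)` with diagonal entries `A_i - B_i`,
superdiagonal entries `B_i` and subdiagonal entries `-A_{i+1}`. -/
def Mmat (m : ℕ) (f : Fin (m + 1) → ℝ → ℝ → ℝ) (V W : Fin (m + 2) → ℝ) :
    Matrix (Fin (m + 1)) (Fin (m + 1)) ℝ :=
  fun k l =>
    if l = k then Aint m f V W k - Bint m f V W k
    else if (l : ℕ) = (k : ℕ) + 1 then Bint m f V W k
    else if (k : ℕ) = (l : ℕ) + 1 then -Aint m f V W k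
    else 0

/-- **Assumption (★).** `N` is a norm `|·|_⋆` on `ℝ^{r-1}` and `lam0 = λ > 0` is such that
for all `V, W ∈ ℝ^r` and all `Δt, ε > 0` the matrix `I - (Δt/ε) M(V, W)` is invertible and
the `⋆`-operator norm of its inverse is at most `(1 + λΔt/ε)⁻¹`. -/
def StarAssumption (m : ℕ) (f : Fin (m + 1) → ℝ → ℝ → ℝ)
    (N : (Fin (m + 1) → ℝ) → ℝ) (lam0 : ℝ) : Prop :=
  (∀ x, 0 ≤ N x) ∧ (∀ x, N x = 0 ↔ x = 0) ∧
  (∀ (c : ℝ) (x), N (c • x) = |c| * N x) ∧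
  (∀ x y, N (x + y) ≤ N x + N y) ∧
  0 < lam0 ∧
  ∀ (V W : Fin (m + 2) → ℝ) (Δt ε : ℝ), 0 < Δt → 0 < ε →
    IsUnit (1 - (Δt / ε) • Mmat m f V W) ∧
    ∀ ξ : Fin (m + 1) → ℝ,
      N ((1 - (Δt / ε) • Mmat m f V W)⁻¹.mulVec ξ)
        ≤ (1 + lam0 * Δt / ε)⁻¹ * N ξ


/-- The set of partial sums approximating the total variation (with respect to the
1-norm on `ℝ^r`) of a function `g : ℝ → ℝ^r`; the total variation `TV(g)` is its
supremum `sSup`. -/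
def tvSet (m : ℕ) (g : ℝ → Fin (m + 2) → ℝ) : Set ℝ :=
  {s | ∃ (k : ℕ) (x : ℕ → ℝ), Monotone x ∧
    s = ∑ l ∈ Finset.range k, onenorm (g (x (l + 1)) - g (x l))}

end

open MeasureTheory Filter


open MeasureTheory Filter

theorem zr_fatou {α : Type*} [MeasurableSpace α] {μ : Measure α} (F : ℕ → α → ENNReal)
    (G : α → ENNReal) (K : ENNReal) (hF : ∀ n, AEMeasurable (F n) μ)
    (h : ∀ᵐ x ∂μ, Tendsto (fun n => F n x) atTop (nhds (G x)))
    (hK : ∀ n, ∫⁻ x, F n x ∂μ ≤ K) : ∫⁻ x, G x ∂μ ≤ K := by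
  have h1 : ∫⁻ x, G x ∂μ = ∫⁻ x, liminf (fun n => F n x) atTop ∂μ := by
    apply lintegral_congr_ae
    filter_upwards [h] with x hx
    exact hx.liminf_eq.symm
  rw [h1]
  refine (lintegral_liminf_le' hF).trans ?_
  refine liminf_le_of_frequently_le' ?_
  exact Frequently.of_forall hK

def BVle (u : ℝ → ℝ) (M : ℝ) : Prop :=
  ∀ (k : ℕ) (x : ℕ → ℝ), Monotone x →
    ∑ l ∈ Finset.range k, |u (x (l + 1)) - u (x l)| ≤ M

theorem BVle.nonneg {u : ℝ → ℝ} {M : ℝ} (h : BVle u M) : 0 ≤ M := by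
  simpa using h 0 (fun _ => 0) monotone_const

theorem BVle.sub_le {u : ℝ → ℝ} {M : ℝ} (h : BVle u M) (x y : ℝ) : |u x - u y| ≤ M := by
  wlog hxy : y ≤ x generalizing x y
  · rw [abs_sub_comm]; exact this y x (le_of_not_ge hxy)
  have := h 1 (fun l => if l = 0 then y else x) (by
    intro a b hab
    by_cases ha : a = 0 <;> by_cases hb : b = 0 <;> simp [ha, hb, hxy]
    omega)
  simpa using this

theorem zr_locInt {α : Type*} [MeasurableSpace α] [TopologicalSpace α]
    {μ : Measure α} [IsLocallyFiniteMeasure μ] {u : α → ℝ} {B : ℝ}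
    (hm : AEStronglyMeasurable u μ) (hb : ∀ᵐ x ∂μ, |u x| ≤ B) : LocallyIntegrable u μ := by
  refine (locallyIntegrable_const B).mono hm ?_
  filter_upwards [hb] with x hx
  exact hx.trans (le_abs_self B)

theorem BVle.locInt {u : ℝ → ℝ} {M : ℝ} (h : BVle u M) (hm : Measurable u) :
    LocallyIntegrable u volume := by
  refine zr_locInt (B := |u 0| + M) hm.aestronglyMeasurable (Eventually.of_forall fun x => ?_)
  have := h.sub_le x 0
  have h2 := abs_sub_abs_le_abs_sub (u x) (u 0)
  linarith

theorem BVle.ii {u : ℝ → ℝ} {M : ℝ} (h : BVle u M) (hm : Measurable u) (a b : ℝ) :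
    IntervalIntegrable u volume a b :=
  ((h.locInt hm).integrableOn_isCompact isCompact_uIcc).intervalIntegrable

theorem BVle.comp_add {u : ℝ → ℝ} {M : ℝ} (h : BVle u M) (c : ℝ) : BVle (fun x => u (x + c)) M :=
  fun k x hx => h k (fun l => x l + c) (fun _ _ hab => add_le_add_left (hx hab) c)

theorem zr_shift_fin {u : ℝ → ℝ} {M : ℝ} (h : BVle u M) (hm : Measurable u) {d : ℝ} (hd : 0 < d)
    (a : ℝ) (N : ℕ) : ∫ x in a..(a + N * d), |u (x + d) - u x| ≤ d * M := by
  have hii : ∀ p q : ℝ, IntervalIntegrable (fun x => |u (x + d) - u x|) volume p q := by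
    intro p q
    refine IntervalIntegrable.abs (IntervalIntegrable.sub ?_ (h.ii hm _ _))
    exact (h.comp_add d).ii (hm.comp (measurable_id.add_const d)) _ _
  have e := intervalIntegral.sum_integral_adjacent_intervals (μ := volume)
    (f := fun x => |u (x + d) - u x|) (a := fun k => a + k * d) (n := N) (fun k _ => hii _ _)
  simp only [Nat.cast_zero, zero_mul, add_zero] at e
  rw [← e]
  have e2 : ∀ k : ℕ, ∫ x in (a + k * d)..(a + ((k + 1 : ℕ) : ℝ) * d), |u (x + d) - u x|
      = ∫ x in (0 : ℝ)..d, |u (x + (a + (k + 1 : ℕ) * d)) - u (x + (a + k * d))| := by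
    intro k
    have := intervalIntegral.integral_comp_add_right (a := 0) (b := d)
      (fun x => |u (x + d) - u x|) (a + k * d)
    rw [zero_add] at this
    rw [show a + ((k + 1 : ℕ) : ℝ) * d = d + (a + k * d) by push_cast; ring, ← this]
    congr 1; ext x; congr 3; ring
  simp_rw [e2]
  have hii2 : ∀ k : ℕ, IntervalIntegrable
      (fun x => |u (x + (a + (k + 1 : ℕ) * d)) - u (x + (a + k * d))|) volume 0 d := fun k =>
    IntervalIntegrable.abs (IntervalIntegrable.sub
      ((h.comp_add _).ii (hm.comp (measurable_id.add_const _)) _ _)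
      ((h.comp_add _).ii (hm.comp (measurable_id.add_const _)) _ _))
  rw [← intervalIntegral.integral_finsetSum]
  · calc _ ≤ ∫ x in (0 : ℝ)..d, M := by
          apply intervalIntegral.integral_mono_on hd.le
          · have := IntervalIntegrable.sum (Finset.range N) fun k _ => hii2 k
            simpa only [Finset.sum_fn] using this
          · simp
          · intro x _
            refine h N (fun k => x + (a + k * d)) ?_
            intro i j hij
            have : (i : ℝ) ≤ j := by exact_mod_cast hij
            simp only
            nlinarith
      _ = d * M := by simp
  · exact fun k _ => hii2 k

theorem zr_shift {u : ℝ → ℝ} {M : ℝ} (h : BVle u M) (hm : Measurable u) {d : ℝ} (hd : 0 ≤ d) :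
    ∫⁻ x, ENNReal.ofReal |u (x + d) - u x| ≤ ENNReal.ofReal (d * M) := by
  rcases hd.eq_or_lt with rfl | hd
  · simp
  have hm' : Measurable fun x => |u (x + d) - u x| := by
    have : Measurable fun x => u (x + d) := hm.comp (measurable_id.add_const d)
    exact (this.sub hm).abs
  refine zr_fatou (fun N : ℕ => (Set.Ioc (-(N * d)) (N * d)).indicator
    (fun x => ENNReal.ofReal |u (x + d) - u x|)) _ _ (fun N => ?_) (Eventually.of_forall fun x => ?_)
    (fun N => ?_)
  · exact (hm'.ennreal_ofReal.indicator measurableSet_Ioc).aemeasurable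
  · refine tendsto_const_nhds.congr' ?_
    obtain ⟨N, hN⟩ := exists_nat_gt (|x| / d)
    filter_upwards [eventually_ge_atTop N] with n hn
    rw [Set.indicator_of_mem]
    have h1 : |x| < n * d := by
      rw [div_lt_iff₀ hd] at hN
      have : (N : ℝ) ≤ n := by exact_mod_cast hn
      nlinarith
    exact ⟨(abs_lt.1 h1).1, (abs_lt.1 h1).2.le⟩
  · rw [lintegral_indicator measurableSet_Ioc]
    have h1 := zr_shift_fin h hm hd (-(N * d)) (2 * N)
    rw [show -(N * d) + ((2 * N : ℕ) : ℝ) * d = N * d by push_cast; ring] at h1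
    rw [intervalIntegral.integral_of_le (by nlinarith [(Nat.cast_nonneg N : (0:ℝ) ≤ N)])] at h1
    rw [← ofReal_integral_eq_lintegral_ofReal]
    · exact ENNReal.ofReal_le_ofReal h1
    · refine Integrable.abs (Integrable.sub ?_ ?_)
      · exact ((h.comp_add d).ii (hm.comp (measurable_id.add_const d)) (-(N * d)) (N * d)).1
      · exact (h.ii hm _ _).1
    · exact Eventually.of_forall fun x => abs_nonneg _

theorem zr_shift_int {u : ℝ → ℝ} {M : ℝ} (h : BVle u M) (hm : Measurable u) {d : ℝ} (hd : 0 ≤ d) :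
    Integrable (fun x => u (x + d) - u x) ∧ ∫ x, |u (x + d) - u x| ≤ d * M := by
  have hm' : Measurable fun x => u (x + d) - u x := by
    have : Measurable fun x => u (x + d) := hm.comp (measurable_id.add_const d)
    exact (this.sub hm)
  have h1 := zr_shift h hm hd
  have h2 : Integrable (fun x => u (x + d) - u x) := by
    refine ⟨hm'.aestronglyMeasurable, ?_⟩
    rw [hasFiniteIntegral_iff_norm]
    exact lt_of_le_of_lt h1 ENNReal.ofReal_lt_top
  refine ⟨h2, ?_⟩
  rw [← ofReal_integral_eq_lintegral_ofReal h2.abs (Eventually.of_forall fun x => abs_nonneg _)] at h1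
  exact (ENNReal.ofReal_le_ofReal_iff (mul_nonneg hd h.nonneg)).1 h1

theorem zr_bvtest {u : ℝ → ℝ} {M : ℝ} (h : BVle u M) (hm : Measurable u) {ψ : ℝ → ℝ}
    (hψ : ContDiff ℝ 1 ψ) (hc : HasCompactSupport ψ) {S : ℝ} (hS : ∀ x, |ψ x| ≤ S) :
    |∫ x, u x * deriv ψ x| ≤ M * S := by
  have hS0 : 0 ≤ S := (abs_nonneg _).trans (hS 0)
  set B := |u 0| + M with hB
  have hub : ∀ x, |u x| ≤ B := fun x => by
    have := h.sub_le x 0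
    have h2 := abs_sub_abs_le_abs_sub (u x) (u 0)
    linarith
  obtain ⟨K, hK⟩ := ContDiff.lipschitzWith_of_hasCompactSupport hc hψ one_ne_zero
  obtain ⟨R, hR⟩ := hc.isCompact.isBounded.subset_closedBall 0
  have hz : ∀ x, R < |x| → ψ x = 0 := fun x hx => by
    by_contra h0
    have := hR (subset_tsupport _ h0)
    simp at this; linarith
  let d : ℕ → ℝ := fun n => 1 / ((n : ℝ) + 1)
  have hd : ∀ n, 0 < d n := fun n => by positivity
  have hd1 : ∀ n, d n ≤ 1 := fun n => by
    simp only [d]; rw [div_le_one (by positivity)]; linarith [(Nat.cast_nonneg n : (0:ℝ) ≤ n)]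
  have hdt : Tendsto d atTop (nhds 0) := tendsto_one_div_add_atTop_nhds_zero_nat
  have hlim : Tendsto (fun n => ∫ x, u x * ((ψ x - ψ (x - d n)) / d n)) atTop
      (nhds (∫ x, u x * deriv ψ x)) := by
    refine tendsto_integral_of_dominated_convergence
      ((Set.Icc (-(R + 1)) (R + 1)).indicator fun _ => B * K) ?_ ?_ ?_ ?_
    · intro n
      have hcψ := hψ.continuous
      exact (hm.mul (by fun_prop)).aestronglyMeasurable
    · rw [integrable_indicator_iff measurableSet_Icc]
      exact integrableOn_const (by simp)
    · intro n
      refine Eventually.of_forall fun x => ?_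
      by_cases hx : x ∈ Set.Icc (-(R + 1)) (R + 1)
      · rw [Set.indicator_of_mem hx, norm_mul, Real.norm_eq_abs, Real.norm_eq_abs]
        refine mul_le_mul (hub x) ?_ (abs_nonneg _) ((abs_nonneg _).trans (hub 0))
        rw [abs_div, abs_of_pos (hd n), div_le_iff₀ (hd n)]
        have := hK.dist_le_mul x (x - d n)
        simpa [Real.dist_eq, abs_of_pos (hd n)] using this
      · have hx2 : R + 1 < |x| := by
          by_contra h0
          exact hx (abs_le.1 (not_lt.1 h0))
        have : R < |x - d n| := by
          have h3 := abs_sub_abs_le_abs_sub x (d n)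
          rw [abs_of_pos (hd n)] at h3
          linarith [hd1 n]
        rw [Set.indicator_of_notMem hx, hz x (by linarith), hz _ this]
        simp
    · refine Eventually.of_forall fun x => ?_
      refine Tendsto.const_mul _ ?_
      have hder := (hψ.differentiable one_ne_zero x).hasDerivAt
      rw [hasDerivAt_iff_tendsto_slope_zero] at hder
      have h4 : Tendsto (fun n => -d n) atTop (nhdsWithin 0 {0}ᶜ) := by
        rw [tendsto_nhdsWithin_iff]
        refine ⟨by simpa using hdt.neg, Eventually.of_forall fun n => by simpa using (hd n).ne'⟩
      refine (hder.comp h4).congr fun n => ?_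
      have := (hd n).ne'
      simp only [Function.comp, smul_eq_mul, ← sub_eq_add_neg]
      field_simp
      ring
  refine le_of_tendsto hlim.abs (Eventually.of_forall fun n => ?_)
  have hli := h.locInt hm
  have hi1 : Integrable (fun x => u x * ψ x) := by
    have := hli.integrable_smul_right_of_hasCompactSupport hψ.continuous hc
    simpa using this
  have hi2 : Integrable (fun x => u (x + d n) * ψ x) := by
    have := ((h.comp_add (d n)).locInt (hm.comp (measurable_id.add_const (d n)))).integrable_smul_right_of_hasCompactSupport hψ.continuous hc
    simpa using this
  have hi3 : Integrable (fun x => u x * ψ (x - d n)) := by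
    have := hi2.comp_sub_right (d n)
    simpa using this
  have e1 : ∫ x, u x * ψ (x - d n) = ∫ x, u (x + d n) * ψ x := by
    have := integral_sub_right_eq_self (μ := volume) (fun x => u (x + d n) * ψ x) (d n)
    simpa using this
  have e2 : ∫ x, u x * ((ψ x - ψ (x - d n)) / d n) = (∫ x, (u x - u (x + d n)) * ψ x) / d n := by
    have e3 : ∫ x, u x * ((ψ x - ψ (x - d n)) / d n)
        = (∫ x, (u x * ψ x - u x * ψ (x - d n))) / d n := by
      rw [← integral_div]; congr 1; ext x; ring
    rw [e3, integral_sub hi1 hi3, e1, ← integral_sub hi1 hi2]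
    congr 2; ext x; ring
  obtain ⟨j1, j2⟩ := zr_shift_int h hm (hd n).le
  rw [e2, abs_div, abs_of_pos (hd n), div_le_iff₀ (hd n)]
  calc |∫ x, (u x - u (x + d n)) * ψ x| ≤ ∫ x, |u (x + d n) - u x| * S := by
        rw [← Real.norm_eq_abs]
        refine norm_integral_le_of_norm_le (j1.abs.mul_const S) (Eventually.of_forall fun x => ?_)
        rw [norm_mul, Real.norm_eq_abs, Real.norm_eq_abs, abs_sub_comm]
        exact mul_le_mul_of_nonneg_left (hS x) (abs_nonneg _)
    _ ≤ M * S * d n := by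
        rw [integral_mul_const]; nlinarith


open MeasureTheory Filter

noncomputable def zavg (u : ℝ → ℝ) (d x : ℝ) : ℝ := ∫ s in (0 : ℝ)..1, u (x + d * s)

theorem zavg_eq (u : ℝ → ℝ) {d : ℝ} (hd : 0 < d) (x : ℝ)
    (hi : ∀ a b, IntervalIntegrable u volume a b) :
    zavg u d x = ((∫ y in (0 : ℝ)..(x + d), u y) - ∫ y in (0 : ℝ)..x, u y) / d := by
  unfold zavg
  rw [intervalIntegral.integral_comp_add_mul u hd.ne' x,
    intervalIntegral.integral_interval_sub_left (hi _ _) (hi _ _)]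
  simp [div_eq_inv_mul]

theorem zavg_meas {u : ℝ → ℝ} (hu : Measurable u) (d : ℝ) : Measurable (zavg u d) := by
  unfold zavg
  simp_rw [intervalIntegral.integral_of_le zero_le_one]
  have : StronglyMeasurable (fun p : ℝ × ℝ => u (p.1 + d * p.2)) :=
    (hu.comp (by fun_prop)).stronglyMeasurable
  exact (this.integral_prod_right (ν := volume.restrict (Set.Ioc 0 1))).measurable

theorem zavg_meas2 {w : ℝ × ℝ → ℝ} (hu : Measurable w) (d : ℝ) :
    Measurable (fun p : ℝ × ℝ => zavg (fun x => w (x, p.2)) d p.1) := by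
  unfold zavg
  simp_rw [intervalIntegral.integral_of_le zero_le_one]
  have : StronglyMeasurable (fun p : (ℝ × ℝ) × ℝ => w (p.1.1 + d * p.2, p.1.2)) :=
    (hu.comp (by fun_prop)).stronglyMeasurable
  exact (this.integral_prod_right (ν := volume.restrict (Set.Ioc 0 1))).measurable

theorem zr_ii_comp {u : ℝ → ℝ} {M : ℝ} (h : BVle u M) (hm : Measurable u) (x d a b : ℝ) :
    IntervalIntegrable (fun s => u (x + d * s)) volume a b := by
  have : LocallyIntegrable (fun s => u (x + d * s)) volume := by
    refine zr_locInt (B := |u 0| + M) (hm.comp (by fun_prop)).aestronglyMeasurable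
      (Eventually.of_forall fun s => ?_)
    have := h.sub_le (x + d * s) 0
    have h2 := abs_sub_abs_le_abs_sub (u (x + d * s)) (u 0)
    linarith
  exact (this.integrableOn_isCompact isCompact_uIcc).intervalIntegrable

theorem zr_abs_avg_le {F : ℝ → ℝ} :
    ENNReal.ofReal |∫ s in (0 : ℝ)..1, F s| ≤ ∫⁻ s in Set.Ioc (0 : ℝ) 1, ENNReal.ofReal |F s| := by
  rw [intervalIntegral.integral_of_le zero_le_one]
  have := enorm_integral_le_lintegral_enorm (μ := volume.restrict (Set.Ioc (0:ℝ) 1)) F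
  simpa [Real.enorm_eq_ofReal_abs] using this

theorem zavg_close {u : ℝ → ℝ} {M : ℝ} (h : BVle u M) (hm : Measurable u) {d : ℝ} (hd : 0 ≤ d) :
    ∫⁻ x, ENNReal.ofReal |u x - zavg u d x| ≤ ENNReal.ofReal (d * M) := by
  have e : ∀ x, u x - zavg u d x = ∫ s in (0 : ℝ)..1, (u x - u (x + d * s)) := fun x => by
    rw [intervalIntegral.integral_sub (by simp) (zr_ii_comp h hm _ _ _ _)]
    simp [zavg]
  calc _ ≤ ∫⁻ x, ∫⁻ s in Set.Ioc (0 : ℝ) 1, ENNReal.ofReal |u x - u (x + d * s)| := by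
        refine lintegral_mono fun x => ?_
        simp only [e]
        exact zr_abs_avg_le
    _ = ∫⁻ s in Set.Ioc (0 : ℝ) 1, ∫⁻ x, ENNReal.ofReal |u x - u (x + d * s)| := by
        rw [lintegral_lintegral_swap]
        refine Measurable.aemeasurable ?_
        have h1 : Measurable fun p : ℝ × ℝ => u (p.1 + d * p.2) := hm.comp (by fun_prop)
        exact ((hm.comp measurable_fst).sub h1).abs.ennreal_ofReal
    _ ≤ ∫⁻ s in Set.Ioc (0 : ℝ) 1, ENNReal.ofReal (d * M) := by
        refine setLIntegral_mono measurable_const fun s hs => ?_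
        have e5 : ∀ x, |u x - u (x + d * s)| = |u (x + d * s) - u x| := fun x => abs_sub_comm _ _
        simp only [e5]
        refine (zr_shift h hm (mul_nonneg hd hs.1.le)).trans (ENNReal.ofReal_le_ofReal ?_)
        nlinarith [hs.2, hs.1, h.nonneg, mul_nonneg hd h.nonneg]
    _ = _ := by simp

theorem zavg_lip {u w : ℝ → ℝ} {M : ℝ} (h : BVle u M) (hm : Measurable u)
    (h' : BVle w M) (hm' : Measurable w) (d : ℝ) :
    ∫⁻ x, ENNReal.ofReal |zavg u d x - zavg w d x| ≤ ∫⁻ x, ENNReal.ofReal |u x - w x| := by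
  have e : ∀ x, zavg u d x - zavg w d x = ∫ s in (0 : ℝ)..1, (u (x + d * s) - w (x + d * s)) :=
    fun x => by
      rw [intervalIntegral.integral_sub (zr_ii_comp h hm _ _ _ _) (zr_ii_comp h' hm' _ _ _ _)]
      simp [zavg]
  calc _ ≤ ∫⁻ x, ∫⁻ s in Set.Ioc (0 : ℝ) 1, ENNReal.ofReal |u (x + d * s) - w (x + d * s)| := by
        refine lintegral_mono fun x => ?_
        simp only [e]
        exact zr_abs_avg_le
    _ = ∫⁻ s in Set.Ioc (0 : ℝ) 1, ∫⁻ x, ENNReal.ofReal |u (x + d * s) - w (x + d * s)| := by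
        rw [lintegral_lintegral_swap]
        refine Measurable.aemeasurable ?_
        have h1 : Measurable fun p : ℝ × ℝ => u (p.1 + d * p.2) := hm.comp (by fun_prop)
        have h2 : Measurable fun p : ℝ × ℝ => w (p.1 + d * p.2) := hm'.comp (by fun_prop)
        exact (h1.sub h2).abs.ennreal_ofReal
    _ = ∫⁻ s in Set.Ioc (0 : ℝ) 1, ∫⁻ x, ENNReal.ofReal |u x - w x| := by
        congr 1; ext s
        exact lintegral_add_right_eq_self (fun x => ENNReal.ofReal |u x - w x|) (d * s)
    _ = _ := by simp

theorem BVle.anti {u : ℝ → ℝ} {M : ℝ} (h : BVle u M) (k : ℕ) (x : ℕ → ℝ) (hx : Antitone x) :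
    ∑ l ∈ Finset.range k, |u (x l) - u (x (l + 1))| ≤ M := by
  have := h k (fun l => x (k - l)) (fun a b hab => hx (by omega))
  rw [← Finset.sum_range_reflect] at this
  refine le_trans (le_of_eq (Finset.sum_congr rfl fun l hl => ?_)) this
  have hl := Finset.mem_range.1 hl
  rw [show k - (k - 1 - l + 1) = l by omega, show k - (k - 1 - l) = l + 1 by omega]

theorem zavg_dyadic {u : ℝ → ℝ} {M : ℝ} (h : BVle u M) (hm : Measurable u) (x : ℝ) (J : ℕ) :
    ∑ j ∈ Finset.range J, |zavg u ((1/2)^j) (x + (1/2)^j)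
      - zavg u ((1/2)^(j+1)) (x + (1/2)^(j+1))| ≤ M := by
  have hi : ∀ j : ℕ, IntervalIntegrable (fun s => |u (x + (1/2)^j + (1/2)^j * s)
      - u (x + (1/2)^(j+1) + (1/2)^(j+1) * s)|) volume 0 1 := fun j =>
    ((zr_ii_comp h hm _ _ _ _).sub (zr_ii_comp h hm _ _ _ _)).abs
  calc _ ≤ ∑ j ∈ Finset.range J, ∫ s in (0 : ℝ)..1, |u (x + (1/2)^j + (1/2)^j * s)
      - u (x + (1/2)^(j+1) + (1/2)^(j+1) * s)| := by
        refine Finset.sum_le_sum fun j _ => ?_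
        unfold zavg
        rw [← intervalIntegral.integral_sub (zr_ii_comp h hm _ _ _ _) (zr_ii_comp h hm _ _ _ _)]
        exact intervalIntegral.abs_integral_le_integral_abs zero_le_one
    _ = ∫ s in (0 : ℝ)..1, ∑ j ∈ Finset.range J, |u (x + (1/2)^j + (1/2)^j * s)
      - u (x + (1/2)^(j+1) + (1/2)^(j+1) * s)| := by
        rw [intervalIntegral.integral_finsetSum]
        exact fun j _ => hi j
    _ ≤ ∫ s in (0 : ℝ)..1, M := by
        apply intervalIntegral.integral_mono_on zero_le_one
        · simpa only [Finset.sum_fn] using IntervalIntegrable.sum (Finset.range J) fun k _ => hi k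
        · simp
        · intro s hs
          refine h.anti J (fun j => x + (1/2)^j + (1/2)^j * s) (fun a b hab => ?_)
          have : ((1:ℝ)/2)^b ≤ (1/2)^a := pow_le_pow_of_le_one (by norm_num) (by norm_num) hab
          have := mul_le_mul_of_nonneg_right this hs.1
          simp only
          linarith
    _ = M := by simp

theorem zr_dyadic_conv (a b : ℕ → ℝ) (B M : ℝ) (hab : ∀ j, a j = (a (j+1) + b (j+1)) / 2)
    (ha : ∀ j, |a j| ≤ B) (hb : ∀ J, ∑ j ∈ Finset.range J, |b j - b (j+1)| ≤ M) :
    ∃ L, Tendsto a atTop (nhds L) := by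
  have hs : Summable fun j => dist (b j) (b (j+1)) :=
    summable_of_sum_range_le (fun _ => dist_nonneg) hb
  obtain ⟨L, hL⟩ := cauchySeq_tendsto_of_complete (cauchySeq_of_summable_dist hs)
  refine ⟨L, ?_⟩
  rw [Metric.tendsto_atTop] at hL ⊢
  intro e he
  obtain ⟨J, hJ⟩ := hL (e/2) (by positivity)
  refine ⟨J, fun j hj => ?_⟩
  have key : ∀ n : ℕ, ∀ j ≥ J, |a j - L| ≤ e/2 + (1/2)^n * (B + |L|) := by
    intro n
    induction n with
    | zero =>
      intro j _
      have := abs_sub (a j) L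
      have := ha j
      simp; linarith
    | succ n ih =>
      intro j hj
      have h1 := ih (j+1) (by omega)
      have h2 := hJ (j+1) (by omega)
      rw [Real.dist_eq] at h2
      rw [show a j - L = ((a (j+1) - L) + (b (j+1) - L))/2 by rw [hab j]; ring, abs_div, abs_two]
      have := abs_add_le (a (j+1) - L) (b (j+1) - L)
      rw [pow_succ]
      linarith
  have hlim : Tendsto (fun n : ℕ => e/2 + ((1:ℝ)/2)^n * (B + |L|)) atTop (nhds (e/2 + 0 * (B+|L|))) :=
    ((tendsto_pow_atTop_nhds_zero_of_lt_one (by norm_num) (by norm_num)).mul_const _).const_add _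
  have := ge_of_tendsto' hlim (fun n => key n j hj)
  rw [Real.dist_eq]; linarith

theorem onenorm_nonneg {r : ℕ} (V : Fin r → ℝ) : 0 ≤ onenorm V :=
  Finset.sum_nonneg fun _ _ => abs_nonneg _

theorem abs_le_onenorm {r : ℕ} (V : Fin r → ℝ) (i : Fin r) : |V i| ≤ onenorm V :=
  Finset.single_le_sum (f := fun i => |V i|) (fun _ _ => abs_nonneg _) (Finset.mem_univ i)

theorem onenorm_cont {r : ℕ} : Continuous (onenorm : (Fin r → ℝ) → ℝ) := by
  unfold onenorm; fun_prop

theorem onenorm_ofReal {r : ℕ} (V : Fin r → ℝ) :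
    ENNReal.ofReal (onenorm V) = ∑ i, ENNReal.ofReal |V i| :=
  ENNReal.ofReal_sum_of_nonneg fun _ _ => abs_nonneg _

theorem zr_comp {m : ℕ} {V : ℝ → Fin (m+2) → ℝ} {M : ℝ} (h : ∀ s ∈ tvSet m V, s ≤ M)
    (i : Fin (m+2)) : BVle (fun x => V x i) M := by
  intro k x hx
  refine le_trans (Finset.sum_le_sum fun l _ => ?_) (h _ ⟨k, x, hx, rfl⟩)
  exact abs_le_onenorm (V (x (l+1)) - V (x l)) i

theorem zr_onenorm_int {r : ℕ} {F : Fin r → ℝ → ℝ} (hF : ∀ i, IntervalIntegrable (F i) volume 0 1) :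
    onenorm (fun i => ∫ s in (0:ℝ)..1, F i s) ≤ ∫ s in (0:ℝ)..1, onenorm (fun i => F i s) := by
  unfold onenorm
  rw [intervalIntegral.integral_finsetSum (fun i _ => (hF i).abs)]
  exact Finset.sum_le_sum fun i _ => intervalIntegral.abs_integral_le_integral_abs zero_le_one

theorem zr_onenorm_ii {r : ℕ} {F : Fin r → ℝ → ℝ} (hF : ∀ i, IntervalIntegrable (F i) volume 0 1) :
    IntervalIntegrable (fun s => onenorm (fun i => F i s)) volume 0 1 := by
  have := IntervalIntegrable.sum Finset.univ fun i _ => (hF i).abs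
  simpa only [Finset.sum_fn, onenorm] using this

theorem zavg_tv {m : ℕ} {V : ℝ → Fin (m+2) → ℝ} {M : ℝ} (h : ∀ s ∈ tvSet m V, s ≤ M)
    (hm : ∀ i, Measurable fun x => V x i) {d : ℝ}  :
    ∀ s ∈ tvSet m (fun x i => zavg (fun y => V y i) d x), s ≤ M := by
  rintro s ⟨k, x, hx, rfl⟩
  have hii : ∀ l (i : Fin (m+2)), IntervalIntegrable
      (fun s => V (x (l+1) + d * s) i - V (x l + d * s) i) volume 0 1 := fun l i =>
    (zr_ii_comp (zr_comp h i) (hm i) _ _ _ _).sub (zr_ii_comp (zr_comp h i) (hm i) _ _ _ _)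
  calc _ ≤ ∑ l ∈ Finset.range k, ∫ s in (0:ℝ)..1,
        onenorm (fun i => V (x (l+1) + d * s) i - V (x l + d * s) i) := by
        refine Finset.sum_le_sum fun l _ => ?_
        refine le_trans (le_of_eq ?_) (zr_onenorm_int (hii l))
        congr 1; ext i
        rw [intervalIntegral.integral_sub (zr_ii_comp (zr_comp h i) (hm i) _ _ _ _)
          (zr_ii_comp (zr_comp h i) (hm i) _ _ _ _)]
        rfl
    _ = ∫ s in (0:ℝ)..1, ∑ l ∈ Finset.range k,
        onenorm (fun i => V (x (l+1) + d * s) i - V (x l + d * s) i) := by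
        rw [intervalIntegral.integral_finsetSum (fun l _ => zr_onenorm_ii (hii l))]
    _ ≤ ∫ s in (0:ℝ)..1, M := by
        apply intervalIntegral.integral_mono_on zero_le_one
        · simpa only [Finset.sum_fn] using
            IntervalIntegrable.sum (Finset.range k) fun l _ => zr_onenorm_ii (hii l)
        · simp
        · intro s hs
          exact h _ ⟨k, fun l => x l + d * s, fun a b hab => add_le_add_left (hx hab) _, rfl⟩
    _ = M := by simp

theorem zavg_onenorm {m : ℕ} {V : ℝ → Fin (m+2) → ℝ} {M : ℝ} (h : ∀ s ∈ tvSet m V, s ≤ M)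
    (hm : ∀ i, Measurable fun x => V x i) {d : ℝ} (hd : 0 < d) (hb : ∀ᵐ x, onenorm (V x) ≤ M)
    (x : ℝ) : onenorm (fun i => zavg (fun y => V y i) d x) ≤ M := by
  have hii := fun i => zr_ii_comp (zr_comp h i) (hm i) x d 0 1
  refine (zr_onenorm_int hii).trans ?_
  have : ∫ s in (0:ℝ)..1, onenorm (fun i => V (x + d * s) i) ≤ ∫ s in (0:ℝ)..1, M := by
    apply intervalIntegral.integral_mono_ae zero_le_one (zr_onenorm_ii hii) (by simp)
    have hq : Measure.QuasiMeasurePreserving (fun s : ℝ => x + d * s) := by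
      have h1 : Measure.QuasiMeasurePreserving (fun s : ℝ => d * s) := by
        refine ⟨by fun_prop, ?_⟩
        rw [Real.map_volume_mul_left hd.ne']
        exact Measure.smul_absolutelyContinuous
      exact (measurePreserving_add_left volume x).quasiMeasurePreserving.comp h1
    exact hq.ae hb
  simpa using this


open MeasureTheory Filter

theorem Qr_contDiff {m : ℕ} {f : Fin (m + 1) → ℝ → ℝ → ℝ}
    (hf1 : ∀ i, ContDiff ℝ 1 fun p : ℝ × ℝ => f i p.1 p.2) : ContDiff ℝ 1 (Qr m f) := by
  have h1 : ∀ i : Fin (m+1), ContDiff ℝ 1 fun U : Fin (m+2) → ℝ => f i (U i.castSucc) (U i.succ) :=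
    fun i => (hf1 i).comp (f := fun U : Fin (m+2) → ℝ => (U i.castSucc, U i.succ))
      ((contDiff_apply ℝ ℝ _).prodMk (contDiff_apply ℝ ℝ _))
  rw [contDiff_pi]
  intro k
  unfold Qr
  refine ContDiff.sub (ContDiff.sum fun i _ => ?_) (ContDiff.sum fun i _ => ?_)
  · by_cases h : k = i.castSucc
    · simpa only [h, if_true] using h1 i
    · simpa only [h, if_false] using contDiff_const
  · by_cases h : k = i.succ
    · simpa only [h, if_true] using h1 i
    · simpa only [h, if_false] using contDiff_const

theorem norm_le_onenorm {r : ℕ} (V : Fin r → ℝ) : ‖V‖ ≤ onenorm V :=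
  (pi_norm_le_iff_of_nonneg (onenorm_nonneg V)).2 fun i => abs_le_onenorm V i

theorem Qr_lip {m : ℕ} {f : Fin (m + 1) → ℝ → ℝ → ℝ}
    (hf1 : ∀ i, ContDiff ℝ 1 fun p : ℝ × ℝ => f i p.1 p.2) (B : ℝ) :
    ∃ K : ℝ, 0 ≤ K ∧ ∀ V W : Fin (m+2) → ℝ, onenorm V ≤ B → onenorm W ≤ B → ∀ i,
      |Qr m f V i - Qr m f W i| ≤ K * onenorm (V - W) := by
  obtain ⟨K, hK⟩ := (Qr_contDiff hf1).contDiffOn.exists_lipschitzOnWith one_ne_zero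
    (convex_closedBall (0 : Fin (m+2) → ℝ) B) (isCompact_closedBall _ _)
  refine ⟨K, K.2, fun V W hV hW i => ?_⟩
  have h1 := hK.dist_le_mul V (by simpa using (norm_le_onenorm V).trans hV)
    W (by simpa using (norm_le_onenorm W).trans hW)
  have h2 := dist_le_pi_dist (Qr m f V) (Qr m f W) i
  rw [Real.dist_eq] at h2
  refine h2.trans (h1.trans (mul_le_mul_of_nonneg_left ?_ K.2))
  rw [dist_eq_norm]
  exact norm_le_onenorm _

theorem Qr_sum {m : ℕ} (f : Fin (m + 1) → ℝ → ℝ → ℝ) (V : Fin (m+2) → ℝ) :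
    ∑ i, Qr m f V i = 0 := by
  unfold Qr
  rw [Finset.sum_sub_distrib, Finset.sum_comm, Finset.sum_comm (s := Finset.univ (α := Fin (m+2)))]
  simp

theorem Qr_of_eq {m : ℕ} {f : Fin (m + 1) → ℝ → ℝ → ℝ} {V : Fin (m+2) → ℝ}
    (h : ∀ i : Fin (m+1), f i (V i.castSucc) (V i.succ) = 0) (k) : Qr m f V k = 0 := by
  simp [Qr, h]

theorem eq_of_Qr {m : ℕ} {f : Fin (m + 1) → ℝ → ℝ → ℝ} {V : Fin (m+2) → ℝ}
    (h : ∀ k, Qr m f V k = 0) (i : Fin (m+1)) : f i (V i.castSucc) (V i.succ) = 0 := by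
  induction i using Fin.induction with
  | zero =>
    have := h 0
    simp only [Qr] at this
    rw [Finset.sum_eq_single 0, Finset.sum_eq_zero] at this
    · simpa using this
    · intro i _; rw [if_neg]; exact (Fin.succ_ne_zero i).symm
    · intro b _ hb; rw [if_neg]; intro h0; apply hb
      exact (Fin.castSucc_injective _ (by simpa using h0)).symm
    · simp
  | succ i ih =>
    have := h i.succ.castSucc
    simp only [Qr] at this
    rw [Finset.sum_eq_single i.succ, Finset.sum_eq_single i.castSucc] at this
    · simpa [ih] using this
    · intro b _ hb; rw [if_neg]; intro h0; apply hb
      exact (Fin.succ_injective _ (by simpa using h0)).symm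
    · simp
    · intro b _ hb; rw [if_neg]; intro h0; apply hb
      exact (Fin.castSucc_injective _ (by simpa using h0)).symm
    · simp

open scoped Convolution in
theorem zr_testfn {g : ℝ × ℝ → ℝ} (hg : ContDiff ℝ 1 g) (hc : HasCompactSupport g) :
    ∃ φ : ℝ × ℝ → ℝ, ContDiff ℝ 1 φ ∧ HasCompactSupport φ ∧
      (∀ x t, 0 ≤ t → φ (x, t) = ∫ s in Set.Ioi t, g (x, s)) ∧
      (∀ x t, 0 < t → fderiv ℝ φ (x, t) (0, 1) = - g (x, t)) := by
  obtain ⟨R, hR⟩ := hc.isCompact.isBounded.subset_closedBall 0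
  have hz : ∀ p : ℝ × ℝ, R < ‖p‖ → g p = 0 := fun x hx => by
    by_contra h0
    have := hR (subset_tsupport _ h0)
    simp at this; linarith
  have hzx : ∀ x t, R < |x| → g (x, t) = 0 := fun x t h => hz _ (lt_of_lt_of_le h (norm_fst_le (x,t)))
  have hzt : ∀ x t, R < |t| → g (x, t) = 0 := fun x t h => hz _ (lt_of_lt_of_le h (norm_snd_le (x,t)))
  have hgc := hg.continuous
  have hgi : ∀ x, Integrable (fun s => g (x, s)) := fun x => by
    refine Continuous.integrable_of_hasCompactSupport (by fun_prop) ?_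
    refine HasCompactSupport.intro (isCompact_Icc (a := -R) (b := R)) fun s hs => hzt x s ?_
    by_contra h0
    exact hs (abs_le.1 (not_lt.1 h0))
  let F : ℝ → ℝ := (Set.Iic (0:ℝ)).indicator fun _ => 1
  have hF : LocallyIntegrable F volume := by
    refine zr_locInt (B := 1) ((measurable_const.indicator measurableSet_Iic).aestronglyMeasurable)
      (Eventually.of_forall fun x => ?_)
    by_cases hx : x ∈ Set.Iic (0:ℝ) <;> simp [F, hx]
  let Φ : ℝ × ℝ → ℝ := fun q => (F ⋆[ContinuousLinearMap.lsmul ℝ ℝ, volume] (fun s => g (q.1, s))) q.2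
  have hΦ : ContDiff ℝ 1 Φ := by
    rw [← contDiffOn_univ, ← Set.univ_prod_univ]
    refine contDiffOn_convolution_right_with_param (n := 1) (g := fun x s => g (x, s))
      (ContinuousLinearMap.lsmul ℝ ℝ)
      isOpen_univ (isCompact_Icc (a := -R) (b := R)) ?_ hF ?_
    · intro p x _ hx
      refine hzt p x ?_
      by_contra h0
      exact hx (abs_le.1 (not_lt.1 h0))
    · exact hg.contDiffOn
  have hΦe : ∀ x t, Φ (x, t) = ∫ s in Set.Ioi t, g (x, s) := by
    intro x t
    rw [← integral_Ici_eq_integral_Ioi, ← integral_indicator measurableSet_Ici,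
      ← integral_sub_left_eq_self _ volume t]
    simp only [Φ, convolution]
    congr 1; ext s
    by_cases hs : s ≤ 0 <;> simp [F, hs, Set.indicator]
  have hder : ∀ x t, HasDerivAt (fun t => Φ (x, t)) (-g (x, t)) t := by
    intro x t
    have e : (fun t => Φ (x, t)) = fun t => (∫ s in Set.Ioi (0:ℝ), g (x, s)) - ∫ s in (0:ℝ)..t, g (x, s) := by
      ext t
      rw [hΦe, ← intervalIntegral.integral_interval_add_Ioi (hgi x).integrableOn (hgi x).integrableOn (a := 0) (b := t)]
      ring
    rw [e]
    have : Continuous fun s => g (x, s) := by fun_prop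
    simpa using (this.integral_hasStrictDerivAt 0 t).hasDerivAt.const_sub (∫ s in Set.Ioi (0:ℝ), g (x, s))
  refine ⟨fun p => Real.smoothTransition (p.2 + 1) * Φ p, ?_, ?_, ?_, ?_⟩
  · exact (Real.smoothTransition.contDiff.comp (contDiff_snd.add contDiff_const)).mul hΦ
  · refine HasCompactSupport.intro (K := Set.Icc (-R) R ×ˢ Set.Icc (-1) R)
      (isCompact_Icc.prod isCompact_Icc) ?_
    rintro ⟨x, t⟩ hp
    by_cases hx : R < |x|
    · have : Φ (x, t) = 0 := by rw [hΦe]; simp [hzx x _ hx]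
      simp [this]
    by_cases ht : t < -1
    · have : Real.smoothTransition (t + 1) = 0 := Real.smoothTransition.zero_of_nonpos (by linarith)
      simp [this]
    by_cases ht' : R < t
    · have : Φ (x, t) = 0 := by
        rw [hΦe]
        refine setIntegral_eq_zero_of_forall_eq_zero fun s hs => hzt x s ?_
        exact lt_of_lt_of_le (ht'.trans hs) (le_abs_self s)
      simp [this]
    · exact absurd ⟨abs_le.1 (not_lt.1 hx), not_lt.1 ht, not_lt.1 ht'⟩ hp
  · intro x t ht
    simp only
    rw [Real.smoothTransition.one_of_one_le (by linarith), one_mul, hΦe]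
  · intro x t ht
    have hev : (fun p : ℝ × ℝ => Real.smoothTransition (p.2 + 1) * Φ p) =ᶠ[nhds (x, t)] Φ := by
      have : {p : ℝ × ℝ | 0 < p.2} ∈ nhds (x, t) :=
        (isOpen_lt continuous_const continuous_snd).mem_nhds ht
      filter_upwards [this] with p hp
      have hp' : 0 < p.2 := hp
      rw [Real.smoothTransition.one_of_one_le (by linarith), one_mul]
    rw [hev.fderiv_eq]
    have h1 := (hΦ.differentiable one_ne_zero (x, t)).hasFDerivAt
    have h2 : HasDerivAt (fun s : ℝ => (x, s)) ((0:ℝ), (1:ℝ)) t := (hasDerivAt_const t x).prodMk (hasDerivAt_id t)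
    exact (h1.comp_hasDerivAt t h2).unique (hder x t)


open MeasureTheory Filter

noncomputable def zmu : Measure (ℝ × ℝ) :=
  (volume : Measure ℝ).prod ((volume : Measure ℝ).restrict (Set.Ioi 0))

theorem zmu_eq : zmu = (volume : Measure (ℝ × ℝ)).restrict (Set.univ ×ˢ Set.Ioi 0) := by
  unfold zmu
  rw [Measure.volume_eq_prod, ← Measure.prod_restrict, Measure.restrict_univ]

instance : SFinite zmu := by unfold zmu; infer_instance
instance : IsLocallyFiniteMeasure zmu := by rw [zmu_eq]; infer_instance

theorem zmu_ae {Z : ℝ × ℝ → Prop} (h : ∀ᵐ p : ℝ × ℝ, 0 < p.2 → Z p) : ∀ᵐ p ∂zmu, Z p := by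
  rw [zmu_eq, ae_restrict_iff' (MeasurableSet.univ.prod measurableSet_Ioi)]
  filter_upwards [h] with p hp h2
  exact hp h2.2

theorem zmu_pos : ∀ᵐ p ∂zmu, 0 < p.2 := zmu_ae (Eventually.of_forall fun _ h => h)

theorem zmu_ae_vol {Z : ℝ × ℝ → Prop} (h : ∀ᵐ p ∂zmu, Z p) : ∀ᵐ p : ℝ × ℝ, 0 < p.2 → Z p := by
  rw [zmu_eq, ae_restrict_iff' (MeasurableSet.univ.prod measurableSet_Ioi)] at h
  filter_upwards [h] with p hp h2
  exact hp ⟨trivial, h2⟩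

theorem zmu_fst {Z : ℝ → Prop} (h : ∀ᵐ x, Z x) : ∀ᵐ p ∂zmu, Z p.1 :=
  Measure.quasiMeasurePreserving_fst.ae h

theorem zmu_slice {Z : ℝ × ℝ → Prop} (h : ∀ᵐ p ∂zmu, Z p) :
    ∀ᵐ t, 0 < t → ∀ᵐ x, Z (x, t) := by
  unfold zmu at h
  have h1 := (Measure.measurePreserving_swap (μ := (volume : Measure ℝ).restrict (Set.Ioi 0))
    (ν := (volume : Measure ℝ))).quasiMeasurePreserving.ae h
  have h2 := Measure.ae_ae_of_ae_prod h1
  rw [ae_restrict_iff' measurableSet_Ioi] at h2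
  filter_upwards [h2] with t ht h0
  exact ht h0

theorem zmu_iter {F : ℝ × ℝ → ℝ} (h : Integrable F zmu) :
    ∫ t in Set.Ioi (0:ℝ), ∫ x, F (x, t) = ∫ p, F p ∂zmu := by
  unfold zmu at *
  rw [integral_prod_symm _ h]

theorem zmu_int {a b : ℝ × ℝ → ℝ} {B : ℝ} (ha : Measurable a) (hB : ∀ᵐ p ∂zmu, |a p| ≤ B)
    (hb : Continuous b) (hc : HasCompactSupport b) : Integrable (fun p => a p * b p) zmu := by
  refine Integrable.bdd_mul (c := B) ?_ ha.aestronglyMeasurable hB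
  rw [zmu_eq]
  exact (hb.integrable_of_hasCompactSupport hc).integrableOn

theorem zr_fderiv_x {φ : ℝ × ℝ → ℝ} (hφ : ContDiff ℝ 1 φ) (x t : ℝ) :
    fderiv ℝ φ (x, t) (1, 0) = deriv (fun y => φ (y, t)) x := by
  have h1 := (hφ.differentiable one_ne_zero (x, t)).hasFDerivAt
  have h2 : HasDerivAt (fun s : ℝ => (s, t)) ((1:ℝ), (0:ℝ)) x :=
    (hasDerivAt_id x).prodMk (hasDerivAt_const x t)
  exact (h1.comp_hasDerivAt x h2).deriv.symm

theorem zr_cont_dir {φ : ℝ × ℝ → ℝ} (hφ : ContDiff ℝ 1 φ) (v : ℝ × ℝ) :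
    Continuous fun p => fderiv ℝ φ p v :=
  (hφ.continuous_fderiv one_ne_zero).clm_apply continuous_const

theorem zr_supp_dir {φ : ℝ × ℝ → ℝ} (hc : HasCompactSupport φ) (v : ℝ × ℝ) :
    HasCompactSupport fun p => fderiv ℝ φ p v :=
  hc.fderiv_apply (𝕜 := ℝ) v

theorem zmu_box (β X T : ℝ) : Integrable
    ((Set.Icc (-X) X ×ˢ Set.Ioc 0 T).indicator (fun p : ℝ × ℝ => Real.exp (-β * p.2))) zmu := by
  rw [integrable_indicator_iff (measurableSet_Icc.prod measurableSet_Ioc)]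
  have : IntegrableOn (fun p : ℝ × ℝ => Real.exp (-β * p.2)) (Set.Icc (-X) X ×ˢ Set.Icc 0 T) zmu :=
    ContinuousOn.integrableOn_compact (isCompact_Icc.prod isCompact_Icc) (by fun_prop)
  exact this.mono_set (Set.prod_mono le_rfl Set.Ioc_subset_Icc_self)

theorem zmu_boxint {q : ℝ × ℝ → ℝ} {B β X T : ℝ} (hqm : Measurable q)
    (hqb : ∀ᵐ p ∂zmu, |q p| ≤ B) : Integrable (fun p => |q p| *
      (Set.Icc (-X) X ×ˢ Set.Ioc 0 T).indicator (fun p => Real.exp (-β * p.2)) p) zmu := by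
  refine Integrable.bdd_mul (c := B) (zmu_box β X T) hqm.abs.aestronglyMeasurable ?_
  filter_upwards [hqb] with p hp
  simpa using hp

/-- the key estimate for one component against one test function -/
theorem zr_key {u u0 q : ℝ × ℝ → ℝ} {M B l e β X T : ℝ}
    (hM : 0 ≤ M) (hβ : 0 < β) (he : 0 < e) (hT : 0 ≤ T)
    (hum : Measurable u) (hqm : Measurable q)
    (hub : ∀ᵐ p ∂zmu, |u p| ≤ B) (hqb : ∀ᵐ p ∂zmu, |q p| ≤ B)
    (u0' : ℝ → ℝ) (hu0 : ∀ p, u0 p = u0' p.1) (hu0m : Measurable u0') (hu0b : ∀ x, |u0' x| ≤ B)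
    (htv : ∀ t, 0 < t → BVle (fun x => u (x, t)) M)
    (hweak : ∀ φ : ℝ × ℝ → ℝ, ContDiff ℝ 1 φ → HasCompactSupport φ →
      (∫ t in Set.Ioi (0 : ℝ), ∫ x : ℝ, (u (x, t) * fderiv ℝ φ (x, t) (0, 1)
          + l * u (x, t) * fderiv ℝ φ (x, t) (1, 0) + (1 / e) * q (x, t) * φ (x, t)))
        + (∫ x : ℝ, u0' x * φ (x, 0)) = 0)
    {g : ℝ × ℝ → ℝ} (hg : ContDiff ℝ 1 g) (hc : HasCompactSupport g)
    (hgb : ∀ p, |g p| ≤ Real.exp (-β * p.2)) (hgx : ∀ x t, X < |x| → g (x, t) = 0)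
    (hgt : ∀ x t, T < t → g (x, t) = 0) :
    ∫ p, (u p - u0 p) * g p ∂zmu ≤ |l| * (M / β * T) + 1 / e / β * ∫ p, |q p| *
      (Set.Icc (-X) X ×ˢ Set.Ioc 0 T).indicator (fun p => Real.exp (-β * p.2)) p ∂zmu := by
  obtain ⟨φ, h1, h2, h3, h4⟩ := zr_testfn hg hc
  -- bounds of φ
  have hφb : ∀ x t, 0 < t → |φ (x, t)| ≤ Real.exp (-β * t) / β := by
    intro x t ht
    rw [h3 x t ht.le]
    have : ∫ s in Set.Ioi t, Real.exp (-β * s) = Real.exp (-β * t) / β := by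
      rw [integral_exp_mul_Ioi (by linarith)]; rw [neg_div_neg_eq]
    rw [← this, ← Real.norm_eq_abs]
    exact norm_integral_le_of_norm_le (integrableOn_exp_mul_Ioi (by linarith) t)
      (Eventually.of_forall fun s => hgb (x, s))
  have hφx : ∀ x t, 0 < t → X < |x| → φ (x, t) = 0 := by
    intro x t ht hx
    rw [h3 x t ht.le]; simp [hgx x _ hx]
  have hφt : ∀ x t, 0 < t → T < t → φ (x, t) = 0 := by
    intro x t ht hx
    rw [h3 x t ht.le]
    exact setIntegral_eq_zero_of_forall_eq_zero fun s hs => hgt x s (hx.trans hs)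
  -- integrability
  have i1 : Integrable (fun p => u p * fderiv ℝ φ p (0, 1)) zmu :=
    zmu_int hum hub (zr_cont_dir h1 _) (zr_supp_dir h2 _)
  have i2 : Integrable (fun p => u p * fderiv ℝ φ p (1, 0)) zmu :=
    zmu_int hum hub (zr_cont_dir h1 _) (zr_supp_dir h2 _)
  have i3 : Integrable (fun p => q p * φ p) zmu := zmu_int hqm hqb h1.continuous h2
  have hu0m' : Measurable u0 := by
    have : u0 = fun p => u0' p.1 := funext hu0
    rw [this]; exact hu0m.comp measurable_fst
  have hu0b' : ∀ᵐ p ∂zmu, |u0 p| ≤ B := Eventually.of_forall fun p => by rw [hu0]; exact hu0b _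
  have i4 : Integrable (fun p => u0 p * g p) zmu := zmu_int hu0m' hu0b' hg.continuous hc
  have i5 : Integrable (fun p => u p * g p) zmu := zmu_int hum hub hg.continuous hc
  have w := hweak φ h1 h2
  have e1 : (∫ t in Set.Ioi (0 : ℝ), ∫ x : ℝ, (u (x, t) * fderiv ℝ φ (x, t) (0, 1)
          + l * u (x, t) * fderiv ℝ φ (x, t) (1, 0) + (1 / e) * q (x, t) * φ (x, t)))
      = -(∫ p, u p * g p ∂zmu) + l * (∫ p, u p * fderiv ℝ φ p (1, 0) ∂zmu)
        + 1 / e * ∫ p, q p * φ p ∂zmu := by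
    have i6 : Integrable (fun p => u p * fderiv ℝ φ p (0, 1)
      + l * (u p * fderiv ℝ φ p (1, 0))) zmu := i1.add (i2.const_mul l)
    have i7 : Integrable (fun p => u p * fderiv ℝ φ p (0, 1)
      + l * (u p * fderiv ℝ φ p (1, 0)) + 1 / e * (q p * φ p)) zmu := i6.add (i3.const_mul (1/e))
    have := zmu_iter i7
    rw [integral_add i6 (i3.const_mul _), integral_add i1 (i2.const_mul l), integral_const_mul,
      integral_const_mul] at this
    have e0 : ∫ p, u p * fderiv ℝ φ p (0, 1) ∂zmu = -(∫ p, u p * g p ∂zmu) := by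
      rw [← integral_neg]
      refine integral_congr_ae ?_
      filter_upwards [zmu_pos] with p hp
      have := h4 p.1 p.2 hp
      simp only [Prod.mk.eta] at this
      rw [this]; ring
    rw [e0] at this
    rw [← this]
    congr 1; ext t; congr 1; ext x; ring
  have e2 : ∫ x : ℝ, u0' x * φ (x, 0) = ∫ p, u0 p * g p ∂zmu := by
    unfold zmu at i4 ⊢
    rw [integral_prod _ i4]
    congr 1; ext x
    simp only [hu0]
    rw [integral_const_mul, h3 x 0 le_rfl]
  rw [e1, e2] at w
  have e3 : ∫ p, (u p - u0 p) * g p ∂zmu = (∫ p, u p * g p ∂zmu) - ∫ p, u0 p * g p ∂zmu := by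
    rw [← integral_sub i5 i4]; congr 1; ext p; ring
  -- transport term
  have b1 : |∫ p, u p * fderiv ℝ φ p (1, 0) ∂zmu| ≤ M / β * T := by
    rw [← zmu_iter i2]
    have hk : ∀ t ∈ Set.Ioi (0:ℝ), ‖∫ x, u (x, t) * fderiv ℝ φ (x, t) (1, 0)‖
        ≤ (Set.Ioc 0 T).indicator (fun _ => M / β) t := by
      intro t ht
      simp only [zr_fderiv_x h1]
      by_cases htT : t ≤ T
      · rw [Set.indicator_of_mem (show t ∈ Set.Ioc 0 T from ⟨ht, htT⟩)]
        have : M / β = M * (1 / β) := by ring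
        rw [this]
        refine zr_bvtest (htv t ht) (hum.comp (by fun_prop)) (ψ := fun x => φ (x, t)) ?_ ?_ ?_
        · exact h1.comp (contDiff_id.prodMk contDiff_const)
        · refine HasCompactSupport.intro (isCompact_Icc (a := -X) (b := X)) fun s hs => hφx s t ht ?_
          by_contra h0
          exact hs (abs_le.1 (not_lt.1 h0))
        · intro x
          refine (hφb x t ht).trans ?_
          refine div_le_div_of_nonneg_right ?_ hβ.le
          rw [Real.exp_le_one_iff]
          have : (0:ℝ) < t := ht
          nlinarith
      · have : (fun y => φ (y, t)) = fun _ => 0 := funext fun y => hφt y t ht (not_le.1 htT)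
        rw [this]; simp [htT]
    calc _ ≤ ∫ t in Set.Ioi (0:ℝ), (Set.Ioc 0 T).indicator (fun _ => M / β) t := by
          rw [← Real.norm_eq_abs]
          refine norm_integral_le_of_norm_le ?_ ?_
          · refine Integrable.integrableOn ?_
            rw [integrable_indicator_iff measurableSet_Ioc]
            exact integrableOn_const (by simp)
          · filter_upwards [ae_restrict_mem measurableSet_Ioi] with t ht using hk t ht
      _ = M / β * T := by
          rw [setIntegral_indicator measurableSet_Ioc]
          have : Set.Ioi (0:ℝ) ∩ Set.Ioc 0 T = Set.Ioc 0 T :=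
            Set.inter_eq_right.2 fun x hx => hx.1
          rw [this]
          simp [hT, mul_comm]
  -- source term
  have b2 : |∫ p, q p * φ p ∂zmu| ≤ 1 / β * ∫ p, |q p| *
      (Set.Icc (-X) X ×ˢ Set.Ioc 0 T).indicator (fun p => Real.exp (-β * p.2)) p ∂zmu := by
    rw [← integral_const_mul, ← Real.norm_eq_abs]
    refine norm_integral_le_of_norm_le ?_ ?_
    · exact (zmu_boxint hqm hqb).const_mul _
    · filter_upwards [zmu_pos] with p hp
      rw [norm_mul, Real.norm_eq_abs, Real.norm_eq_abs]
      by_cases hpb : p ∈ Set.Icc (-X) X ×ˢ Set.Ioc 0 T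
      · rw [Set.indicator_of_mem hpb]
        have := mul_le_mul_of_nonneg_left (hφb p.1 p.2 hp) (abs_nonneg (q p))
        refine this.trans (le_of_eq ?_)
        ring
      · rw [Set.indicator_of_notMem hpb]
        have : φ p = 0 := by
          by_cases hx : X < |p.1|
          · exact hφx p.1 p.2 hp hx
          by_cases ht : T < p.2
          · exact hφt p.1 p.2 hp ht
          exact absurd ⟨abs_le.1 (not_lt.1 hx), hp, not_lt.1 ht⟩ hpb
        simp [this]
  rw [e3]
  have c1 : l * (∫ p, u p * fderiv ℝ φ p (1, 0) ∂zmu) ≤ |l| * (M / β * T) := by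
    refine (le_abs_self _).trans ?_
    rw [abs_mul]
    exact mul_le_mul_of_nonneg_left b1 (abs_nonneg _)
  have c2 := mul_le_mul_of_nonneg_left ((le_abs_self _).trans b2) (by positivity : 0 ≤ 1 / e)
  have c3 : ∀ I : ℝ, 1 / e / β * I = 1 / e * (1 / β * I) := fun I => by ring
  rw [c3]
  linarith


open MeasureTheory Filter

open scoped Convolution in
theorem zr_mollify {s : ℝ × ℝ → ℝ} (hs : Measurable s) (hb : ∀ p, |s p| ≤ 1) {X T : ℝ}
    (h0 : ∀ p, p ∉ Set.Icc (-X) X ×ˢ Set.Ioc 0 T → s p = 0) :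
    ∃ σ : ℕ → ℝ × ℝ → ℝ, (∀ n, ContDiff ℝ 1 (σ n)) ∧ (∀ (n : ℕ) (p : ℝ × ℝ), |σ n p| ≤ 1) ∧
      (∀ (n : ℕ) (x t : ℝ), X + 1 / ((n:ℝ) + 1) < |x| → σ n (x, t) = 0) ∧
      (∀ (n : ℕ) (x t : ℝ), T + 1 / ((n:ℝ) + 1) < t → σ n (x, t) = 0) ∧
      (∀ n, HasCompactSupport (σ n)) ∧
      (∀ᵐ p : ℝ × ℝ, Tendsto (fun n => σ n p) atTop (nhds (s p))) := by
  have hpos : ∀ n : ℕ, 0 < 1 / ((n:ℝ) + 1) := fun n => by positivity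
  let ρ : ℕ → ContDiffBump (0 : ℝ × ℝ) := fun n =>
    ⟨1 / ((n:ℝ) + 1) / 2, 1 / ((n:ℝ) + 1), half_pos (hpos n), half_lt_self (hpos n)⟩
  have hsl : LocallyIntegrable s (volume : Measure (ℝ × ℝ)) :=
    zr_locInt hs.aestronglyMeasurable (Eventually.of_forall hb)
  let σ : ℕ → ℝ × ℝ → ℝ := fun n =>
    ((ρ n).normed volume ⋆[ContinuousLinearMap.lsmul ℝ ℝ, volume] s)
  have hz : ∀ (n : ℕ) (p : ℝ × ℝ), (∀ y : ℝ × ℝ, ‖y‖ < 1 / ((n:ℝ) + 1) → s (p - y) = 0) → σ n p = 0 := by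
    intro n p h
    simp only [σ, convolution]
    refine integral_eq_zero_of_ae (Eventually.of_forall fun y => ?_)
    by_cases hy : ‖y‖ < 1 / ((n:ℝ) + 1)
    · simp [h y hy]
    · have : (ρ n).normed volume y = 0 := by
        have := (ρ n).support_normed_eq (μ := (volume : Measure (ℝ × ℝ)))
        by_contra hne
        have h2 : y ∈ Function.support ((ρ n).normed volume) := hne
        rw [this] at h2
        simp [ρ] at h2
        exact hy (by simpa using h2)
      simp [this]
  have hzx : ∀ (n : ℕ) (x t : ℝ), X + 1 / ((n:ℝ) + 1) < |x| → σ n (x, t) = 0 := by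
    intro n x t h
    refine hz n _ fun y hy => h0 _ fun hm => ?_
    have h1 : |x - y.1| ≤ X := abs_le.2 hm.1
    have h2 : |y.1| < 1 / ((n:ℝ) + 1) := lt_of_le_of_lt (norm_fst_le y) hy
    have h3 := abs_sub_abs_le_abs_sub x y.1
    linarith
  have hzt : ∀ (n : ℕ) (x t : ℝ), T + 1 / ((n:ℝ) + 1) < t → σ n (x, t) = 0 := by
    intro n x t h
    refine hz n _ fun y hy => h0 _ fun hm => ?_
    have h1 : t - y.2 ≤ T := hm.2.2
    have h2 : |y.2| < 1 / ((n:ℝ) + 1) := lt_of_le_of_lt (norm_snd_le y) hy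
    have h3 := le_abs_self y.2
    linarith
  have hzt2 : ∀ (n : ℕ) (x t : ℝ), t < -(1 / ((n:ℝ) + 1)) → σ n (x, t) = 0 := by
    intro n x t h
    refine hz n _ fun y hy => h0 _ fun hm => ?_
    have h1 : 0 < t - y.2 := hm.2.1
    have h2 : |y.2| < 1 / ((n:ℝ) + 1) := lt_of_le_of_lt (norm_snd_le y) hy
    have h3 := neg_abs_le y.2
    linarith
  refine ⟨σ, fun n => ?_, fun n p => ?_, hzx, hzt, fun n => ?_, ?_⟩
  · exact (ρ n).hasCompactSupport_normed.contDiff_convolution_left (n := 1) _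
      (ρ n).contDiff_normed hsl
  · simp only [σ, convolution]
    rw [← (ρ n).integral_normed (μ := (volume : Measure (ℝ × ℝ))), ← Real.norm_eq_abs]
    refine norm_integral_le_of_norm_le (ρ n).integrable_normed (Eventually.of_forall fun y => ?_)
    have h1 := (ρ n).nonneg_normed (μ := (volume : Measure (ℝ × ℝ))) y
    simp only [ContinuousLinearMap.lsmul_apply, smul_eq_mul, norm_mul, Real.norm_eq_abs]
    rw [abs_of_nonneg h1]
    nlinarith [hb (p - y)]
  · refine HasCompactSupport.intro (K := Set.Icc (-(X + 1 / ((n:ℝ) + 1))) (X + 1 / ((n:ℝ) + 1)) ×ˢ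
      Set.Icc (-(1 / ((n:ℝ) + 1))) (T + 1 / ((n:ℝ) + 1)))
      (isCompact_Icc.prod isCompact_Icc) ?_
    rintro ⟨x, t⟩ hp
    by_cases hx : X + 1 / ((n:ℝ) + 1) < |x|
    · exact hzx n x t hx
    by_cases ht : T + 1 / ((n:ℝ) + 1) < t
    · exact hzt n x t ht
    by_cases ht' : t < -(1 / ((n:ℝ) + 1))
    · exact hzt2 n x t ht'
    exact absurd ⟨abs_le.1 (not_lt.1 hx), not_lt.1 ht', not_lt.1 ht⟩ hp
  · refine ContDiffBump.ae_convolution_tendsto_right_of_locallyIntegrable (K := 2) ?_ ?_ hsl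
    · exact tendsto_one_div_add_atTop_nhds_zero_nat
    · refine Eventually.of_forall fun n => ?_
      simp only [ρ]; linarith

theorem zr_key2 {u u0 q : ℝ × ℝ → ℝ} {M B l e β X T : ℝ}
    (hM : 0 ≤ M) (hβ : 0 < β) (he : 0 < e) (hT : 0 ≤ T)
    (hum : Measurable u) (hqm : Measurable q)
    (hub : ∀ᵐ p ∂zmu, |u p| ≤ B) (hqb : ∀ᵐ p ∂zmu, |q p| ≤ B)
    (u0' : ℝ → ℝ) (hu0 : ∀ p, u0 p = u0' p.1) (hu0m : Measurable u0') (hu0b : ∀ x, |u0' x| ≤ B)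
    (htv : ∀ t, 0 < t → BVle (fun x => u (x, t)) M)
    (hweak : ∀ φ : ℝ × ℝ → ℝ, ContDiff ℝ 1 φ → HasCompactSupport φ →
      (∫ t in Set.Ioi (0 : ℝ), ∫ x : ℝ, (u (x, t) * fderiv ℝ φ (x, t) (0, 1)
          + l * u (x, t) * fderiv ℝ φ (x, t) (1, 0) + (1 / e) * q (x, t) * φ (x, t)))
        + (∫ x : ℝ, u0' x * φ (x, 0)) = 0) :
    ∫ p, |u p - u0 p| * (Set.Icc (-X) X ×ˢ Set.Ioc 0 T).indicator
      (fun p => Real.exp (-β * p.2)) p ∂zmu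
    ≤ |l| * (M / β * (T + 1)) + 1 / e / β * ∫ p, |q p| *
      (Set.Icc (-X) X ×ˢ Set.Ioc 0 T).indicator (fun p => Real.exp (-β * p.2)) p ∂zmu := by
  have hu0m' : Measurable u0 := by
    have : u0 = fun p => u0' p.1 := funext hu0
    rw [this]; exact hu0m.comp measurable_fst
  have hwm : Measurable fun p => u p - u0 p := hum.sub hu0m'
  have hwb : ∀ᵐ p ∂zmu, |u p - u0 p| ≤ 2 * B := by
    filter_upwards [hub] with p hp
    have := abs_sub (u p) (u0 p)
    have h2 := hu0b p.1
    rw [← hu0] at h2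
    linarith
  let box := Set.Icc (-X) X ×ˢ Set.Ioc 0 T
  have hboxm : MeasurableSet box := measurableSet_Icc.prod measurableSet_Ioc
  let sg : ℝ × ℝ → ℝ := fun p => if 0 ≤ u p - u0 p then 1 else -1
  have hsg : Measurable sg :=
    Measurable.ite (measurableSet_le measurable_const hwm) measurable_const measurable_const
  obtain ⟨σ, s1, s2, s3, s4, s5, s6⟩ := zr_mollify (s := box.indicator sg) (X := X) (T := T)
    (hsg.indicator hboxm) (fun p => by
      by_cases hp : p ∈ box
      · rw [Set.indicator_of_mem hp]; simp only [sg]; split_ifs <;> simp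
      · rw [Set.indicator_of_notMem hp]; simp)
    (fun p hp => Set.indicator_of_notMem hp _)
  let δ : ℕ → ℝ := fun n => 1 / ((n:ℝ) + 1)
  have hδ : ∀ n, 0 < δ n := fun n => by positivity
  have hδ1 : ∀ n, δ n ≤ 1 := fun n => by
    simp only [δ]; rw [div_le_one (by positivity)]; linarith [(Nat.cast_nonneg n : (0:ℝ) ≤ n)]
  have hδt : Tendsto δ atTop (nhds 0) := tendsto_one_div_add_atTop_nhds_zero_nat
  let w : ℝ × ℝ → ℝ := fun p => Real.exp (-β * p.2)
  have hsub : ∀ n, Set.Icc (-(X + δ n)) (X + δ n) ×ˢ Set.Ioc 0 (T + δ n) ⊆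
      Set.Icc (-(X + 1)) (X + 1) ×ˢ Set.Ioc 0 (T + 1) := fun n =>
    Set.prod_mono (Set.Icc_subset_Icc (by linarith [hδ1 n]) (by linarith [hδ1 n]))
      (Set.Ioc_subset_Ioc le_rfl (by linarith [hδ1 n]))
  have hwc : Continuous w := by fun_prop
  have hws : ContDiff ℝ 1 w := by
    exact Real.contDiff_exp.comp (contDiff_const.mul contDiff_snd)
  have key : ∀ n, ∫ p, (u p - u0 p) * (w p * σ n p) ∂zmu ≤ |l| * (M / β * (T + 1)) +
      1 / e / β * ∫ p, |q p| * (Set.Icc (-(X + δ n)) (X + δ n) ×ˢ Set.Ioc 0 (T + δ n)).indicator w p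
        ∂zmu := by
    intro n
    have := zr_key (X := X + δ n) (T := T + δ n) hM hβ he (by linarith [hδ n]) hum hqm hub hqb u0' hu0 hu0m hu0b htv
      hweak (g := fun p => w p * σ n p) (hws.mul (s1 n)) ((s5 n).mul_left) (fun p => by
        rw [abs_mul, abs_of_pos (Real.exp_pos _)]
        have := mul_le_mul_of_nonneg_left (s2 n p) (Real.exp_pos (-β * p.2)).le
        rw [mul_one] at this; exact this)
      (fun x t hx => by simp [s3 n x t hx]) (fun x t hx => by simp [s4 n x t hx])
    refine this.trans (add_le_add_left ?_ _)
    refine mul_le_mul_of_nonneg_left ?_ (abs_nonneg _)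
    refine mul_le_mul_of_nonneg_left ?_ (by positivity)
    linarith [hδ1 n]
  have lim1 : Tendsto (fun n => ∫ p, (u p - u0 p) * (w p * σ n p) ∂zmu) atTop
      (nhds (∫ p, |u p - u0 p| * box.indicator w p ∂zmu)) := by
    refine tendsto_integral_of_dominated_convergence (fun p => 2 * B *
      (Set.Icc (-(X + 1)) (X + 1) ×ˢ Set.Ioc 0 (T + 1)).indicator w p) ?_ ?_ ?_ ?_
    · intro n
      exact (hwm.mul (hwc.measurable.mul (s1 n).continuous.measurable)).aestronglyMeasurable
    · exact (zmu_box β (X+1) (T+1)).const_mul _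
    · intro n
      filter_upwards [hwb, zmu_pos] with p hp hp2
      by_cases hm : p ∈ Set.Icc (-(X + 1)) (X + 1) ×ˢ Set.Ioc 0 (T + 1)
      · rw [Set.indicator_of_mem hm, norm_mul, norm_mul, Real.norm_eq_abs, Real.norm_eq_abs,
          Real.norm_eq_abs]
        refine mul_le_mul hp ?_ (by positivity) ((abs_nonneg _).trans hp)
        have hw : |w p| = w p := abs_of_pos (Real.exp_pos _)
        rw [hw]
        have := mul_le_mul_of_nonneg_left (s2 n p) (Real.exp_pos (-β * p.2)).le
        rw [mul_one] at this; exact this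
      · have : σ n p = 0 := by
          by_cases hx : X + δ n < |p.1|
          · exact s3 n p.1 p.2 hx
          by_cases ht : T + δ n < p.2
          · exact s4 n p.1 p.2 ht
          exact absurd (hsub n ⟨abs_le.1 (not_lt.1 hx), hp2, not_lt.1 ht⟩) hm
        rw [Set.indicator_of_notMem hm, this]; simp
    · have s6' : ∀ᵐ p ∂zmu, Tendsto (fun n => σ n p) atTop (nhds (box.indicator sg p)) :=
        zmu_ae (s6.mono fun p hp _ => hp)
      filter_upwards [s6'] with p hp
      have : |u p - u0 p| * box.indicator w p = (u p - u0 p) * (w p * box.indicator sg p) := by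
        by_cases hm : p ∈ box
        · rw [Set.indicator_of_mem hm, Set.indicator_of_mem hm]
          simp only [sg]
          split_ifs with h
          · rw [abs_of_nonneg h]; ring
          · rw [abs_of_neg (not_le.1 h)]; ring
        · rw [Set.indicator_of_notMem hm, Set.indicator_of_notMem hm]; simp
      rw [this]
      exact (hp.const_mul _).const_mul _
  have lim2 : Tendsto (fun n => ∫ p, |q p| * (Set.Icc (-(X + δ n)) (X + δ n) ×ˢ
      Set.Ioc 0 (T + δ n)).indicator w p ∂zmu) atTop (nhds (∫ p, |q p| * box.indicator w p ∂zmu)) := by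
    refine tendsto_integral_of_dominated_convergence (fun p => |q p| *
      (Set.Icc (-(X + 1)) (X + 1) ×ˢ Set.Ioc 0 (T + 1)).indicator w p) ?_ ?_ ?_ ?_
    · intro n
      exact (zmu_boxint (β := β) hqm hqb).aestronglyMeasurable
    · exact zmu_boxint (β := β) hqm hqb
    · intro n
      refine Eventually.of_forall fun p => ?_
      rw [norm_mul, Real.norm_eq_abs, abs_abs]
      refine mul_le_mul_of_nonneg_left ?_ (abs_nonneg _)
      rw [Real.norm_eq_abs, abs_of_nonneg (Set.indicator_nonneg (fun _ _ => (Real.exp_pos _).le) _)]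
      exact Set.indicator_le_indicator_of_subset (hsub n) (fun _ => (Real.exp_pos _).le) p
    · refine Eventually.of_forall fun p => ?_
      refine Tendsto.const_mul _ ?_
      by_cases hm : p ∈ box
      · refine tendsto_const_nhds.congr fun n => ?_
        rw [Set.indicator_of_mem hm, Set.indicator_of_mem]
        exact Set.prod_mono (Set.Icc_subset_Icc (by linarith [hδ n]) (by linarith [hδ n]))
          (Set.Ioc_subset_Ioc le_rfl (by linarith [hδ n])) hm
      · refine tendsto_const_nhds.congr' ?_
        rw [Set.indicator_of_notMem hm]
        have : ∀ᶠ n in atTop, p ∉ Set.Icc (-(X + δ n)) (X + δ n) ×ˢ Set.Ioc 0 (T + δ n) := by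
          by_cases hx : X < |p.1|
          · have := hδt.eventually (gt_mem_nhds (sub_pos.2 hx))
            filter_upwards [this] with n hn h
            have := abs_le.2 h.1
            linarith
          by_cases ht : T < p.2
          · have := hδt.eventually (gt_mem_nhds (sub_pos.2 ht))
            filter_upwards [this] with n hn h
            have := h.2.2
            linarith
          · refine Eventually.of_forall fun n h => hm ⟨abs_le.1 (not_lt.1 hx), h.2.1, not_lt.1 ht⟩
        filter_upwards [this] with n hn
        rw [Set.indicator_of_notMem hn]
  exact le_of_tendsto_of_tendsto' lim1 ((lim2.const_mul _).const_add _) key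


open MeasureTheory Filter

theorem onenorm_sub_le {r : ℕ} (V W : Fin r → ℝ) : onenorm (V - W) ≤ onenorm V + onenorm W := by
  unfold onenorm
  rw [← Finset.sum_add_distrib]
  exact Finset.sum_le_sum fun i _ => abs_sub (V i) (W i)

theorem zr_slice {m : ℕ} {f : Fin (m + 1) → ℝ → ℝ → ℝ}
    (hf1 : ∀ i, ContDiff ℝ 1 fun p : ℝ × ℝ => f i p.1 p.2)
    (lam : Fin (m + 2) → ℝ) {U₀ : ℝ → Fin (m + 2) → ℝ}
    (hU₀m : ∀ i, Measurable fun x => U₀ x i) {Cb : ℝ} (hU₀b : ∀ x, onenorm (U₀ x) ≤ Cb)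
    (hU₀eq : ∀ i : Fin (m + 1), ∀ᵐ x : ℝ, f i (U₀ x i.castSucc) (U₀ x i.succ) = 0)
    {U : ℝ → ℝ → Fin (m + 2) → ℝ} {M e : ℝ} (hM : 0 ≤ M) (he : 0 < e)
    (hUm : ∀ i, Measurable fun p : ℝ × ℝ => U p.1 p.2 i)
    (hUb : ∀ᵐ p : ℝ × ℝ, 0 < p.2 → onenorm (U p.1 p.2) ≤ M)
    (hweak : ∀ φ : ℝ × ℝ → ℝ, ContDiff ℝ 1 φ → HasCompactSupport φ →
        ∀ i : Fin (m + 2),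
          (∫ t in Set.Ioi (0 : ℝ), ∫ x : ℝ,
              (U x t i * fderiv ℝ φ (x, t) (0, 1)
                + lam i * U x t i * fderiv ℝ φ (x, t) (1, 0)
                + (1 / e) * Qr m f (U x t) i * φ (x, t)))
            + (∫ x : ℝ, U₀ x i * φ (x, 0)) = 0)
    (htv : ∀ t : ℝ, 0 < t → ∀ s ∈ tvSet m (fun x => U x t), s ≤ M) :
    ∀ᵐ t : ℝ, 0 < t → ∫⁻ x, ENNReal.ofReal (onenorm (U x t - U₀ x)) < ⊤ := by
  have hCb : 0 ≤ Cb := (onenorm_nonneg _).trans (hU₀b 0)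
  obtain ⟨L, hL, hlip⟩ := Qr_lip hf1 (M + Cb)
  have hUb' := zmu_ae hUb
  have h0 : ∀ᵐ p ∂zmu, ∀ i, f i (U₀ p.1 (Fin.castSucc i)) (U₀ p.1 i.succ) = 0 :=
    zmu_fst (ae_all_iff.2 hU₀eq)
  have hn : ∀ᵐ p ∂zmu, onenorm (U p.1 p.2 - U₀ p.1) ≤ M + Cb := by
    filter_upwards [hUb'] with p hp
    exact (onenorm_sub_le _ _).trans (add_le_add hp (hU₀b _))
  have hq : ∀ᵐ p ∂zmu, ∀ i, |Qr m f (U p.1 p.2) i| ≤ L * onenorm (U p.1 p.2 - U₀ p.1) := by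
    filter_upwards [hUb', h0] with p hp hp0 i
    have := hlip (U p.1 p.2) (U₀ p.1) (by linarith) (by linarith [hU₀b p.1]) i
    rwa [Qr_of_eq hp0, sub_zero] at this
  let B := (M + Cb) + L * (M + Cb)
  have hB : M + Cb ≤ B := le_add_of_nonneg_right (by positivity)
  have hqb : ∀ i, ∀ᵐ p ∂zmu, |Qr m f (U p.1 p.2) i| ≤ B := fun i => by
    filter_upwards [hq, hn] with p hp hp2
    refine (hp i).trans ((mul_le_mul_of_nonneg_left hp2 hL).trans ?_)
    exact le_add_of_nonneg_left (by positivity)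
  have hUm' : Measurable fun p : ℝ × ℝ => U p.1 p.2 := measurable_pi_iff.2 hUm
  have hU₀m' : Measurable fun p : ℝ × ℝ => U₀ p.1 :=
    measurable_pi_iff.2 fun i => (hU₀m i).comp measurable_fst
  have hvm : Measurable fun p : ℝ × ℝ => onenorm (U p.1 p.2 - U₀ p.1) :=
    onenorm_cont.measurable.comp (hUm'.sub hU₀m')
  have hqm : ∀ i, Measurable fun p : ℝ × ℝ => Qr m f (U p.1 p.2) i := fun i =>
    (measurable_pi_apply i).comp ((Qr_contDiff hf1).continuous.measurable.comp hUm')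
  let r : ℝ := ((m + 2 : ℕ) : ℝ)
  have hr : 0 ≤ r := Nat.cast_nonneg _
  let β := 2 * r * L / e + 1
  have hβ : 0 < β := by positivity
  have main : ∀ (X T : ℝ), 0 ≤ T → ∫ p, onenorm (U p.1 p.2 - U₀ p.1) *
      (Set.Icc (-X) X ×ˢ Set.Ioc 0 T).indicator (fun p => Real.exp (-β * p.2)) p ∂zmu ≤
      2 * ∑ i, |lam i| * (M / β * (T + 1)) := by
    intro X T hT
    set ind : ℝ × ℝ → ℝ :=
      (Set.Icc (-X) X ×ˢ Set.Ioc 0 T).indicator (fun p : ℝ × ℝ => Real.exp (-β * p.2)) with hind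
    have hind0 : ∀ p, 0 ≤ ind p := fun p => Set.indicator_nonneg (fun _ _ => (Real.exp_pos _).le) _
    have hvi : Integrable (fun p => onenorm (U p.1 p.2 - U₀ p.1) * ind p) zmu := by
      have := zmu_boxint (β := β) (X := X) (T := T) hvm (hn.mono fun p hp => by
        rw [abs_of_nonneg (onenorm_nonneg _)]; exact hp)
      simpa only [abs_of_nonneg (onenorm_nonneg _)] using this
    have hvii : ∀ i, Integrable (fun p => |U p.1 p.2 i - U₀ p.1 i| * ind p) zmu := fun i => by
      refine zmu_boxint (β := β) (X := X) (T := T) (B := M + Cb)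
        ((hUm i).sub ((hU₀m i).comp measurable_fst)) ?_
      filter_upwards [hn] with p hp
      exact (abs_le_onenorm (U p.1 p.2 - U₀ p.1) i).trans hp
    set E := ∫ p, onenorm (U p.1 p.2 - U₀ p.1) * ind p ∂zmu with hE
    have hE0 : 0 ≤ E := integral_nonneg fun p => mul_nonneg (onenorm_nonneg _) (hind0 p)
    have hEs : E = ∑ i, ∫ p, |U p.1 p.2 i - U₀ p.1 i| * ind p ∂zmu := by
      rw [← integral_finsetSum _ fun i _ => hvii i, hE]
      congr 1; ext p
      simp only [onenorm, Finset.sum_mul]; rfl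
    have hk : ∀ i, ∫ p, |U p.1 p.2 i - U₀ p.1 i| * ind p ∂zmu ≤
        |lam i| * (M / β * (T + 1)) + 1 / e / β * (L * E) := by
      intro i
      have := zr_key2 (u := fun p => U p.1 p.2 i) (u0 := fun p => U₀ p.1 i)
        (q := fun p => Qr m f (U p.1 p.2) i) (M := M) (B := B) (l := lam i) (X := X) hM hβ he hT
        (hUm i) (hqm i) (hUb'.mono fun p hp => (abs_le_onenorm _ i).trans (by linarith)) (hqb i)
        (fun x => U₀ x i) (fun p => rfl) (hU₀m i)
        (fun x => (abs_le_onenorm _ i).trans (by linarith [hU₀b x]))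
        (fun t ht => zr_comp (htv t ht) i) (fun φ h1 h2 => hweak φ h1 h2 i)
      refine this.trans ((add_le_add_iff_left _).2 ?_)
      refine mul_le_mul_of_nonneg_left ?_ (by positivity)
      rw [hE, ← integral_const_mul]
      refine integral_mono_ae (zmu_boxint (hqm i) (hqb i)) (hvi.const_mul L) ?_
      filter_upwards [hq] with p hp
      have := mul_le_mul_of_nonneg_right (hp i) (hind0 p)
      rw [← mul_assoc]; exact this
    have hsum := Finset.sum_le_sum fun i (_ : i ∈ Finset.univ) => hk i
    rw [← hEs, Finset.sum_add_distrib, Finset.sum_const, Finset.card_univ, Fintype.card_fin,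
      nsmul_eq_mul] at hsum
    have hh : ((m + 2 : ℕ) : ℝ) * (1 / e / β * (L * E)) ≤ 1 / 2 * E := by
      have : r * (1 / e / β * (L * E)) = (r * L / e) / β * E := by ring
      change r * (1 / e / β * (L * E)) ≤ _
      rw [this]
      refine mul_le_mul_of_nonneg_right ?_ hE0
      rw [div_le_iff₀ hβ]
      simp only [β]
      have : 2 * r * L / e = 2 * (r * L / e) := by ring
      rw [this]; linarith
    linarith
  -- let X → ∞
  have hlim : ∀ T : ℕ, ∫⁻ p, ENNReal.ofReal (onenorm (U p.1 p.2 - U₀ p.1) *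
      (Set.Ioc (0:ℝ) T).indicator (fun t => Real.exp (-β * t)) p.2) ∂zmu ≤
      ENNReal.ofReal (2 * ∑ i, |lam i| * (M / β * (T + 1))) := by
    intro T
    refine zr_fatou (fun n : ℕ => fun p => ENNReal.ofReal (onenorm (U p.1 p.2 - U₀ p.1) *
      (Set.Icc (-(n:ℝ)) n ×ˢ Set.Ioc (0:ℝ) T).indicator (fun p => Real.exp (-β * p.2)) p)) _ _
      ?_ ?_ ?_
    · intro n
      refine (ENNReal.measurable_ofReal.comp (hvm.mul (Measurable.indicator (by fun_prop)
        (measurableSet_Icc.prod measurableSet_Ioc)))).aemeasurable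
    · refine Eventually.of_forall fun p => ?_
      refine tendsto_const_nhds.congr' ?_
      filter_upwards [eventually_ge_atTop ⌈|p.1|⌉₊] with n hn
      have h1 : |p.1| ≤ n := (Nat.le_ceil _).trans (Nat.cast_le.2 hn)
      congr 2
      by_cases ht : p.2 ∈ Set.Ioc (0:ℝ) T
      · rw [Set.indicator_of_mem ht, Set.indicator_of_mem]
        exact ⟨abs_le.1 h1, ht⟩
      · rw [Set.indicator_of_notMem ht, Set.indicator_of_notMem]
        exact fun h => ht h.2
    · intro n
      rw [← ofReal_integral_eq_lintegral_ofReal]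
      · exact ENNReal.ofReal_le_ofReal (main n T (Nat.cast_nonneg _))
      · have := zmu_boxint (β := β) (X := n) (T := T) hvm (hn.mono fun p hp => by
          rw [abs_of_nonneg (onenorm_nonneg _)]; exact hp)
        simpa only [abs_of_nonneg (onenorm_nonneg _)] using this
      · exact Eventually.of_forall fun p =>
          mul_nonneg (onenorm_nonneg _) (Set.indicator_nonneg (fun _ _ => (Real.exp_pos _).le) _)
  have hT : ∀ T : ℕ, ∀ᵐ t : ℝ, 0 < t → t ≤ T →
      ∫⁻ x, ENNReal.ofReal (onenorm (U x t - U₀ x)) < ⊤ := by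
    intro T
    have hmm : Measurable fun p : ℝ × ℝ => ENNReal.ofReal (onenorm (U p.1 p.2 - U₀ p.1) *
      (Set.Ioc (0:ℝ) T).indicator (fun t => Real.exp (-β * t)) p.2) := by
      refine ENNReal.measurable_ofReal.comp (hvm.mul ?_)
      exact (Measurable.indicator (f := fun t => Real.exp (-β * t)) (by fun_prop)
        measurableSet_Ioc).comp measurable_snd
    have h1 := hlim T
    unfold zmu at h1
    rw [lintegral_prod_symm _ hmm.aemeasurable] at h1
    have h2 := ae_lt_top hmm.lintegral_prod_left' (ne_top_of_le_ne_top ENNReal.ofReal_ne_top h1)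
    rw [ae_restrict_iff' measurableSet_Ioi] at h2
    filter_upwards [h2] with t ht ht0 htT
    have h3 := ht ht0
    simp only [Set.indicator_of_mem (show t ∈ Set.Ioc (0:ℝ) T from ⟨ht0, htT⟩)] at h3
    simp only [ENNReal.ofReal_mul (onenorm_nonneg _)] at h3
    rw [lintegral_mul_const' _ _ ENNReal.ofReal_ne_top] at h3
    by_contra hc
    rw [not_lt, top_le_iff] at hc
    rw [hc, ENNReal.top_mul (by simpa using Real.exp_pos _)] at h3
    exact lt_irrefl _ h3
  filter_upwards [ae_all_iff.2 hT] with t ht h0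
  exact ht ⌈t⌉₊ h0 (Nat.le_ceil t)


open MeasureTheory Filter

theorem zr_arz {r : ℕ} {S : Set (ℝ × ℝ)} {F : ℕ → ℝ × ℝ → Fin r → ℝ} {K : NNReal}
    (hF : ∀ n, LipschitzOnWith K (F n) S) (R : ℝ × ℝ → ℝ) (hR : ∀ n, ∀ p ∈ S, ‖F n p‖ ≤ R p) :
    ∃ (φ : ℕ → ℕ) (P : ℝ × ℝ → Fin r → ℝ), StrictMono φ ∧ LipschitzWith K P ∧
      ∀ p ∈ S, Tendsto (fun n => F (φ n) p) atTop (nhds (P p)) := by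
  classical
  rcases S.eq_empty_or_nonempty with rfl | hne
  · exact ⟨id, fun _ => 0, strictMono_id, LipschitzWith.const 0 |>.weaken zero_le, by simp⟩
  have : Nonempty S := hne.to_subtype
  let d : ℕ → S := TopologicalSpace.denseSeq S
  have hd : DenseRange d := TopologicalSpace.denseRange_denseSeq S
  have hcomp : IsCompact (Set.pi Set.univ fun k : ℕ =>
      Metric.closedBall (0 : Fin r → ℝ) (R (d k))) :=
    isCompact_univ_pi fun k => isCompact_closedBall _ _
  obtain ⟨G, -, φ, hφ, hG⟩ := hcomp.tendsto_subseq (x := fun n k => F n (d k)) (fun n k _ => by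
    simpa using hR n _ (d k).2)
  have hG' : ∀ k, Tendsto (fun n => F (φ n) (d k)) atTop (nhds (G k)) :=
    fun k => (tendsto_pi_nhds.1 hG) k
  have hex : ∀ p : S, ∃ L, Tendsto (fun n => F (φ n) p) atTop (nhds L) := by
    intro p
    refine cauchySeq_tendsto_of_complete (Metric.cauchySeq_iff'.2 fun e he => ?_)
    obtain ⟨k, hk⟩ := hd.exists_dist_lt p (show 0 < e / (4 * (K + 1)) by positivity)
    have hc := (hG' k).cauchySeq
    obtain ⟨N, hN⟩ := Metric.cauchySeq_iff'.1 hc (e / 4) (by positivity)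
    refine ⟨N, fun n hn => ?_⟩
    have h1 := fun n => (hF (φ n)).dist_le_mul p p.2 (d k) (d k).2
    have h2 : (K:ℝ) * dist (p : ℝ × ℝ) (d k) ≤ e / 4 := by
      have hk' : dist (p : ℝ × ℝ) (d k) ≤ e / (4 * (K + 1)) := hk.le
      calc (K:ℝ) * dist (p : ℝ × ℝ) (d k) ≤ (K + 1) * (e / (4 * (K + 1))) := by
            gcongr; linarith
        _ = e / 4 := by field_simp
    have h3 := dist_triangle4 (F (φ n) p) (F (φ n) (d k)) (F (φ N) (d k)) (F (φ N) p)
    have h4 := h1 n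
    have h5 := h1 N
    rw [dist_comm] at h5
    have h6 := hN n hn
    linarith
  choose P hP using hex
  let P' : ℝ × ℝ → Fin r → ℝ := fun p => if h : p ∈ S then P ⟨p, h⟩ else 0
  have hP' : ∀ p ∈ S, Tendsto (fun n => F (φ n) p) atTop (nhds (P' p)) := by
    intro p hp
    simp only [P', dif_pos hp]; exact hP ⟨p, hp⟩
  have hl : LipschitzOnWith K P' S := by
    refine LipschitzOnWith.of_dist_le_mul fun p hp q hq => ?_
    refine le_of_tendsto ((hP' p hp).dist (hP' q hq)) (Eventually.of_forall fun n => ?_)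
    exact (hF (φ n)).dist_le_mul p hp q hq
  obtain ⟨g, hg, hgS⟩ := hl.extend_pi
  exact ⟨φ, g, hφ, hg, fun p hp => by rw [← hgS hp]; exact hP' p hp⟩

theorem zr_fatou2 {α : Type*} [MeasurableSpace α] {μ : Measure α} (F : ℕ → α → ENNReal)
    (G : α → ENNReal) (k : ℕ → ENNReal) (K : ENNReal) (hF : ∀ n, Measurable (F n))
    (h : ∀ x, Tendsto (fun n => F n x) atTop (nhds (G x)))
    (hk : Tendsto k atTop (nhds K))
    (hK : ∀ n, ∫⁻ x, F n x ∂μ ≤ k n) : ∫⁻ x, G x ∂μ ≤ K := by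
  have h1 : ∫⁻ x, G x ∂μ = ∫⁻ x, liminf (fun n => F n x) atTop ∂μ :=
    lintegral_congr fun x => ((h x).liminf_eq).symm
  rw [h1]
  refine (lintegral_liminf_le hF).trans ?_
  rw [← hk.liminf_eq]
  exact liminf_le_liminf (Eventually.of_forall hK)

/-- hypotheses on a sequence on the good time set -/
structure ZH (m : ℕ) (W : ℕ → ℝ → ℝ → Fin (m+2) → ℝ) (M C : ℝ) (G : Set ℝ) : Prop where
  hM : 0 ≤ M
  hC : 0 < C
  pos : ∀ t ∈ G, 0 < t
  conull : ∀ᵐ t : ℝ, 0 < t → t ∈ G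
  meas : ∀ n i, Measurable fun p : ℝ × ℝ => W n p.1 p.2 i
  tv : ∀ n, ∀ t ∈ G, ∀ s ∈ tvSet m (fun x => W n x t), s ≤ M
  bd : ∀ n, ∀ t ∈ G, ∀ᵐ x, onenorm (W n x t) ≤ M
  lip : ∀ n, ∀ t ∈ G, ∀ t₁ ∈ G, ∫⁻ x, ENNReal.ofReal (onenorm (W n x t - W n x t₁)) ≤
    ENNReal.ofReal (C * |t - t₁|)

theorem ZH.dense {m : ℕ} {W : ℕ → ℝ → ℝ → Fin (m+2) → ℝ} {M C : ℝ} {G : Set ℝ}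
    (h : ZH m W M C G) {t : ℝ} (ht : 0 < t) : t ∈ closure G := by
  by_contra hc
  have h1 : (closure G)ᶜ ∩ Set.Ioi 0 ∈ nhds t :=
    inter_mem (isClosed_closure.isOpen_compl.mem_nhds hc) (Ioi_mem_nhds ht)
  have h2 : volume ((closure G)ᶜ ∩ Set.Ioi (0:ℝ)) = 0 := by
    refine measure_mono_null ?_ (ae_iff.1 h.conull)
    rintro s ⟨hs, hs0⟩
    simp only [Set.mem_ofPred_eq, Classical.not_imp]
    exact ⟨hs0, fun hg => hs (subset_closure hg)⟩
  exact (MeasureTheory.Measure.measure_pos_of_mem_nhds volume h1).ne' h2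

theorem ZH.slice {m : ℕ} {W : ℕ → ℝ → ℝ → Fin (m+2) → ℝ} {M C : ℝ} {G : Set ℝ}
    (h : ZH m W M C G) (n t i) : Measurable fun x => W n x t i :=
  (h.meas n i).comp (f := fun x : ℝ => (x, t)) (by fun_prop)

theorem ZH.prim {m : ℕ} {W : ℕ → ℝ → ℝ → Fin (m+2) → ℝ} {M C : ℝ} {G : Set ℝ}
    (h : ZH m W M C G) : ∃ (φ : ℕ → ℕ) (P : ℝ × ℝ → Fin (m+2) → ℝ), StrictMono φ ∧ Continuous P ∧
      ∀ x, ∀ t ∈ G, ∀ i, Tendsto (fun n => ∫ y in (0:ℝ)..x, W (φ n) y t i) atTop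
        (nhds (P (x, t) i)) := by
  have hii : ∀ n, ∀ t ∈ G, ∀ i a b, IntervalIntegrable (fun x => W n x t i) volume a b :=
    fun n t ht i a b => (zr_comp (h.tv n t ht) i).ii (h.slice n t i) a b
  have hx : ∀ n, ∀ t ∈ G, ∀ i a b, |∫ y in a..b, W n y t i| ≤ M * |b - a| := by
    intro n t ht i a b
    rw [← Real.norm_eq_abs]
    refine intervalIntegral.norm_integral_le_of_norm_le_const_ae ?_
    filter_upwards [h.bd n t ht] with x hx _
    exact (abs_le_onenorm _ i).trans hx
  have ht : ∀ n, ∀ t ∈ G, ∀ t₁ ∈ G, ∀ i a, |(∫ y in (0:ℝ)..a, W n y t i) - ∫ y in (0:ℝ)..a, W n y t₁ i|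
      ≤ C * |t - t₁| := by
    intro n t ht t₁ ht₁ i a
    rw [← intervalIntegral.integral_sub (hii n t ht i _ _) (hii n t₁ ht₁ i _ _),
      ← Real.norm_eq_abs, intervalIntegral.norm_intervalIntegral_eq]
    have := (ENNReal.ofReal_le_ofReal (norm_integral_le_integral_norm
      (μ := volume.restrict (Set.uIoc 0 a)) (fun y => W n y t i - W n y t₁ i)))
    rw [ofReal_integral_norm_eq_lintegral_enorm
      ((hii n t ht i 0 a).sub (hii n t₁ ht₁ i 0 a)).def'] at this
    have h2 := this.trans ((setLIntegral_le_lintegral _ _).trans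
      ((lintegral_mono fun x => ?_).trans (h.lip n t ht t₁ ht₁)))
    · rwa [ENNReal.ofReal_le_ofReal_iff (by have := h.hC; positivity)] at h2
    · rw [Real.enorm_eq_ofReal_abs]
      exact ENNReal.ofReal_le_ofReal (abs_le_onenorm (W n x t - W n x t₁) i)
  obtain ⟨φ, P, h1, h2, h3⟩ := zr_arz (S := Set.univ ×ˢ G) (K := (M + C).toNNReal)
    (F := fun n p i => ∫ y in (0:ℝ)..p.1, W n y p.2 i) (fun n => by
      refine LipschitzOnWith.of_dist_le_mul fun p hp q hq => ?_
      rw [Real.coe_toNNReal _ (add_nonneg h.hM h.hC.le)]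
      refine (dist_pi_le_iff (mul_nonneg (add_nonneg h.hM h.hC.le) dist_nonneg)).2 fun i => ?_
      rw [Real.dist_eq]
      have e1 := ht n p.2 hp.2 q.2 hq.2 i p.1
      have e2 := hx n q.2 hq.2 i q.1 p.1
      rw [← intervalIntegral.integral_interval_sub_left (hii n q.2 hq.2 i 0 p.1)
        (hii n q.2 hq.2 i 0 q.1)] at e2
      have e3 := abs_sub_le (∫ y in (0:ℝ)..p.1, W n y p.2 i) (∫ y in (0:ℝ)..p.1, W n y q.2 i)
        (∫ y in (0:ℝ)..q.1, W n y q.2 i)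
      have e4 : |p.1 - q.1| ≤ dist p q := by rw [Prod.dist_eq]; exact le_max_left _ _
      have e5 : |p.2 - q.2| ≤ dist p q := by rw [Prod.dist_eq]; exact le_max_right _ _
      have e6 := mul_le_mul_of_nonneg_left e4 h.hM
      have e7 := mul_le_mul_of_nonneg_left e5 h.hC.le
      linarith) (fun p => M * |p.1|) (fun n p hp => by
      refine (pi_norm_le_iff_of_nonneg (mul_nonneg h.hM (abs_nonneg _))).2 fun i => ?_
      have := hx n p.2 hp.2 i 0 p.1
      rwa [sub_zero] at this)
  exact ⟨φ, P, h1, h2.continuous, fun x t ht i => tendsto_pi_nhds.1 (h3 (x, t) ⟨trivial, ht⟩) i⟩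


open MeasureTheory Filter

theorem ZH.lim {m : ℕ} {W : ℕ → ℝ → ℝ → Fin (m+2) → ℝ} {M C : ℝ} {G : Set ℝ}
    (h : ZH m W M C G) : ∃ (φ : ℕ → ℕ) (A : ℕ → ℝ → ℝ → Fin (m+2) → ℝ)
      (Us : ℝ → ℝ → Fin (m+2) → ℝ), StrictMono φ ∧
      (∀ j, Continuous fun p : ℝ × ℝ => A j p.1 p.2) ∧
      (∀ j x, ∀ t ∈ G, Tendsto (fun n => fun i => zavg (fun y => W (φ n) y t i) ((1/2)^j) x) atTop
        (nhds (A j x t))) ∧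
      (∀ j x t, 0 < t → onenorm (A j x t) ≤ M) ∧
      (∀ x t, 0 < t → Tendsto (fun j => A j x t) atTop (nhds (Us x t))) ∧
      (Measurable fun p : ℝ × ℝ => Us p.1 p.2) ∧
      (∀ x t, 0 < t → onenorm (Us x t) ≤ M) ∧
      (∀ t, 0 < t → ∀ s ∈ tvSet m (fun x => Us x t), s ≤ M) ∧
      (∀ t t₁, 0 < t → 0 < t₁ → ∫⁻ x, ENNReal.ofReal (onenorm (Us x t - Us x t₁)) ≤
        ENNReal.ofReal (C * |t - t₁|)) := by
  obtain ⟨φ, P, hφ, hP, hlim⟩ := h.prim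
  have hii : ∀ n, ∀ t ∈ G, ∀ i a b, IntervalIntegrable (fun x => W n x t i) volume a b :=
    fun n t ht i a b => (zr_comp (h.tv n t ht) i).ii (h.slice n t i) a b
  let A : ℕ → ℝ → ℝ → Fin (m+2) → ℝ := fun j x t i =>
    (P (x + (1/2)^j, t) i - P (x, t) i) / (1/2)^j
  have hd : ∀ j : ℕ, (0:ℝ) < (1/2)^j := fun j => by positivity
  have hAc : ∀ j, Continuous fun p : ℝ × ℝ => A j p.1 p.2 := by
    intro j
    refine continuous_pi fun i => Continuous.div_const (Continuous.sub ?_ ?_) _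
    · exact (continuous_apply i).comp (hP.comp (by fun_prop))
    · exact (continuous_apply i).comp (hP.comp (by fun_prop))
  have hAt : ∀ j x, Continuous fun t => A j x t := fun j x =>
    (hAc j).comp (f := fun t : ℝ => (x, t)) (by fun_prop)
  have hAx : ∀ j t, Continuous fun x => A j x t := fun j t =>
    (hAc j).comp (f := fun x : ℝ => (x, t)) (by fun_prop)
  have hA : ∀ j x, ∀ t ∈ G, Tendsto (fun n => fun i => zavg (fun y => W (φ n) y t i) ((1/2)^j) x)
      atTop (nhds (A j x t)) := by
    intro j x t ht
    refine tendsto_pi_nhds.2 fun i => ?_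
    have e0 := fun n => zavg_eq _ (hd j) x (hii (φ n) t ht i)
    simp only [e0]
    exact ((hlim _ t ht i).sub (hlim _ t ht i)).div_const _
  have ext : ∀ Z : ℝ → Prop, IsClosed {t | Z t} → (∀ t ∈ G, Z t) → ∀ t, 0 < t → Z t := by
    intro Z hZ hG t ht
    exact (closure_minimal (s := G) (t := {t | Z t}) hG hZ) (h.dense ht)
  have hAb : ∀ j x t, 0 < t → onenorm (A j x t) ≤ M := by
    intro j x
    refine ext _ (isClosed_le (onenorm_cont.comp (hAt j x)) continuous_const) fun t ht => ?_
    exact le_of_tendsto ((onenorm_cont.tendsto _).comp (hA j x t ht)) (Eventually.of_forall fun n =>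
      zavg_onenorm (h.tv _ t ht) (h.slice _ t) (hd j) (h.bd _ t ht) x)
  have hAtv : ∀ j t, 0 < t → ∀ s ∈ tvSet m (fun x => A j x t), s ≤ M := by
    rintro j t ht s ⟨k, x, hx, rfl⟩
    refine ext (fun t => ∑ l ∈ Finset.range k, onenorm (A j (x (l + 1)) t - A j (x l) t) ≤ M)
      (isClosed_le (continuous_finsetSum _ fun l _ =>
        onenorm_cont.comp ((hAt j _).sub (hAt j _))) continuous_const) (fun t ht => ?_) t ht
    refine le_of_tendsto (tendsto_finsetSum _ fun l _ => (onenorm_cont.tendsto _).comp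
      ((hA j _ t ht).sub (hA j _ t ht))) (Eventually.of_forall fun n => ?_)
    exact zavg_tv (h.tv _ t ht) (h.slice _ t) _ ⟨k, x, hx, rfl⟩
  have hAd : ∀ x t i, 0 < t → ∀ J, ∑ j ∈ Finset.range J,
      |A j (x + (1/2)^j) t i - A (j+1) (x + (1/2)^(j+1)) t i| ≤ M := by
    intro x t i ht J
    refine ext (fun t => ∑ j ∈ Finset.range J,
      |A j (x + (1/2)^j) t i - A (j+1) (x + (1/2)^(j+1)) t i| ≤ M)
      (isClosed_le (continuous_finsetSum _ fun l _ =>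
        (((continuous_apply i).comp (hAt _ _)).sub ((continuous_apply i).comp (hAt _ _))).abs)
        continuous_const) (fun t ht => ?_) t ht
    refine le_of_tendsto (tendsto_finsetSum _ fun l _ => ((tendsto_pi_nhds.1 (hA _ _ t ht) i).sub
      (tendsto_pi_nhds.1 (hA _ _ t ht) i)).abs) (Eventually.of_forall fun n => ?_)
    exact zavg_dyadic (zr_comp (h.tv _ t ht) i) (h.slice _ t i) x J
  have hAl : ∀ j t t₁, 0 < t → 0 < t₁ → ∫⁻ x, ENNReal.ofReal (onenorm (A j x t - A j x t₁)) ≤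
        ENNReal.ofReal (C * |t - t₁|) := by
    have hGG : ∀ j, ∀ t ∈ G, ∀ t₁ ∈ G, ∫⁻ x, ENNReal.ofReal (onenorm (A j x t - A j x t₁)) ≤
        ENNReal.ofReal (C * |t - t₁|) := by
      intro j t ht t₁ ht₁
      refine zr_fatou2 (fun n x => ENNReal.ofReal (onenorm
        ((fun i => zavg (fun y => W (φ n) y t i) ((1/2)^j) x) -
          fun i => zavg (fun y => W (φ n) y t₁ i) ((1/2)^j) x))) _ _ _ ?_ ?_ tendsto_const_nhds ?_
      · intro n
        refine ENNReal.measurable_ofReal.comp (onenorm_cont.measurable.comp (Measurable.sub ?_ ?_))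
        · exact measurable_pi_iff.2 fun i => zavg_meas (h.slice _ t i) _
        · exact measurable_pi_iff.2 fun i => zavg_meas (h.slice _ t₁ i) _
      · intro x
        refine (ENNReal.continuous_ofReal.tendsto _).comp ((onenorm_cont.tendsto _).comp
          ((hA j x t ht).sub (hA j x t₁ ht₁)))
      · intro n
        refine le_trans ?_ (h.lip (φ n) t ht t₁ ht₁)
        simp only [onenorm_ofReal]
        rw [lintegral_finsetSum, lintegral_finsetSum]
        · exact Finset.sum_le_sum fun i _ => zavg_lip (zr_comp (h.tv _ t ht) i) (h.slice _ t i)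
            (zr_comp (h.tv _ t₁ ht₁) i) (h.slice _ t₁ i) _
        · intro i _
          exact ENNReal.measurable_ofReal.comp
            (((h.slice _ t i).sub (h.slice _ t₁ i)).abs)
        · intro i _
          exact ENNReal.measurable_ofReal.comp
            (((zavg_meas (h.slice _ t i) _).sub (zavg_meas (h.slice _ t₁ i) _)).abs)
    intro j t t₁ ht ht₁
    obtain ⟨s, hs, hst⟩ := mem_closure_iff_seq_limit.1 (h.dense ht)
    obtain ⟨s₁, hs₁, hst₁⟩ := mem_closure_iff_seq_limit.1 (h.dense ht₁)
    refine zr_fatou2 (fun n x => ENNReal.ofReal (onenorm (A j x (s n) - A j x (s₁ n)))) _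
      (fun n => ENNReal.ofReal (C * |s n - s₁ n|)) _ ?_ ?_ ?_ (fun n => hGG j _ (hs n) _ (hs₁ n))
    · intro n
      exact ENNReal.measurable_ofReal.comp
        (onenorm_cont.measurable.comp ((hAx j _).sub (hAx j _)).measurable)
    · intro x
      exact (ENNReal.continuous_ofReal.tendsto _).comp ((onenorm_cont.tendsto _).comp
          ((((hAt j x).tendsto t).comp hst).sub (((hAt j x).tendsto t₁).comp hst₁)))
    · exact (ENNReal.continuous_ofReal.tendsto _).comp ((hst.sub hst₁).abs.const_mul C)
  have hex : ∀ x t, ∃ L : Fin (m+2) → ℝ, 0 < t → Tendsto (fun j => A j x t) atTop (nhds L) := by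
    intro x t
    by_cases ht : 0 < t
    · have : ∀ i, ∃ L, Tendsto (fun j => A j x t i) atTop (nhds L) := fun i => by
        refine zr_dyadic_conv _ (fun j => A j (x + (1/2)^j) t i) M M (fun j => ?_)
          (fun j => (abs_le_onenorm _ i).trans (hAb j x t ht)) (hAd x t i ht)
        simp only [A]
        have e1 : x + (1/2:ℝ)^(j+1) + (1/2)^(j+1) = x + (1/2)^j := by ring
        rw [e1, pow_succ]
        have := (hd j).ne'
        field_simp
        ring
      choose L hL using this
      exact ⟨L, fun _ => tendsto_pi_nhds.2 hL⟩
    · exact ⟨0, fun h => absurd h ht⟩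
  choose L hL using hex
  let Us : ℝ → ℝ → Fin (m+2) → ℝ := fun x t => if 0 < t then L x t else 0
  have hUs : ∀ x t, 0 < t → Tendsto (fun j => A j x t) atTop (nhds (Us x t)) := by
    intro x t ht
    simp only [Us, if_pos ht]; exact hL x t ht
  refine ⟨φ, A, Us, hφ, hAc, hA, hAb, hUs, ?_, ?_, ?_, ?_⟩
  · refine measurable_of_tendsto_metrizable (f := fun j (p : ℝ × ℝ) =>
      if 0 < p.2 then A j p.1 p.2 else 0) (fun j => ?_) (tendsto_pi_nhds.2 fun p => ?_)
    · exact Measurable.ite (measurableSet_lt measurable_const measurable_snd) (hAc j).measurable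
        measurable_const
    · by_cases hp : 0 < p.2
      · simp only [if_pos hp]; exact hUs _ _ hp
      · simp only [if_neg hp, Us]; exact tendsto_const_nhds
  · intro x t ht
    exact le_of_tendsto ((onenorm_cont.tendsto _).comp (hUs x t ht))
      (Eventually.of_forall fun j => hAb j x t ht)
  · rintro t ht s ⟨k, x, hx, rfl⟩
    refine le_of_tendsto (tendsto_finsetSum _ fun l _ => (onenorm_cont.tendsto _).comp
      ((hUs _ t ht).sub (hUs _ t ht))) (Eventually.of_forall fun j => ?_)
    exact hAtv j t ht _ ⟨k, x, hx, rfl⟩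
  · intro t t₁ ht ht₁
    refine zr_fatou2 (fun j x => ENNReal.ofReal (onenorm (A j x t - A j x t₁))) _ _ _ ?_ ?_
      tendsto_const_nhds (fun j => hAl j t t₁ ht ht₁)
    · intro n
      exact ENNReal.measurable_ofReal.comp
        (onenorm_cont.measurable.comp ((hAx _ _).sub (hAx _ _)).measurable)
    · intro x
      exact (ENNReal.continuous_ofReal.tendsto _).comp ((onenorm_cont.tendsto _).comp
          ((hUs x t ht).sub (hUs x t₁ ht₁)))


open MeasureTheory Filter

theorem zmu_snd {Z : ℝ → Prop} (h : ∀ᵐ t, 0 < t → Z t) : ∀ᵐ p ∂zmu, Z p.2 := by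
  refine Measure.quasiMeasurePreserving_snd.ae ?_
  rw [ae_restrict_iff' measurableSet_Ioi]
  exact h

theorem onenorm_tri {r : ℕ} (V W : Fin r → ℝ) : onenorm (V + W) ≤ onenorm V + onenorm W := by
  unfold onenorm
  rw [← Finset.sum_add_distrib]
  exact Finset.sum_le_sum fun i _ => abs_add_le (V i) (W i)

theorem onenorm_zero {r : ℕ} : onenorm (0 : Fin r → ℝ) = 0 := by simp [onenorm]

theorem zmu_box_lt_top (R : ℝ) : zmu (Set.Icc (-R) R ×ˢ Set.Ioc 0 R) < ⊤ := by
  refine (measure_mono (Set.prod_mono le_rfl Set.Ioc_subset_Icc_self)).trans_lt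
    (IsCompact.measure_lt_top (isCompact_Icc.prod isCompact_Icc))

theorem ZH.conv {m : ℕ} {W : ℕ → ℝ → ℝ → Fin (m+2) → ℝ} {M C : ℝ} {G : Set ℝ}
    (h : ZH m W M C G) (hb : ∀ n, ∀ᵐ p ∂zmu, onenorm (W n p.1 p.2) ≤ M) : ∃ (φ : ℕ → ℕ)
      (Us : ℝ → ℝ → Fin (m+2) → ℝ), StrictMono φ ∧
      (Measurable fun p : ℝ × ℝ => Us p.1 p.2) ∧
      (∀ x t, 0 < t → onenorm (Us x t) ≤ M) ∧
      (∀ t, 0 < t → ∀ s ∈ tvSet m (fun x => Us x t), s ≤ M) ∧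
      (∀ t t₁, 0 < t → 0 < t₁ → ∫⁻ x, ENNReal.ofReal (onenorm (Us x t - Us x t₁)) ≤
        ENNReal.ofReal (C * |t - t₁|)) ∧
      ∀ R, 0 ≤ R → Tendsto (fun n => ∫ p in Set.Icc (-R) R ×ˢ Set.Ioc 0 R,
        onenorm (W (φ n) p.1 p.2 - Us p.1 p.2) ∂zmu) atTop (nhds 0) := by
  obtain ⟨φ, A, Us, hφ, hAc, hA, hAb, hUs, hUm, hUb, hUtv, hUl⟩ := h.lim
  refine ⟨φ, Us, hφ, hUm, hUb, hUtv, hUl, fun R hR => ?_⟩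
  set ν := zmu.restrict (Set.Icc (-R) R ×ˢ Set.Ioc 0 R) with hν
  have hfin : IsFiniteMeasure ν := ⟨by rw [hν, Measure.restrict_apply_univ]; exact zmu_box_lt_top R⟩
  have toν : ∀ {Z : ℝ × ℝ → Prop}, (∀ᵐ p ∂zmu, Z p) → ∀ᵐ p ∂ν, Z p := fun hZ =>
    ae_restrict_of_ae hZ
  have hGν : ∀ᵐ p ∂ν, p.2 ∈ G := toν (zmu_snd h.conull)
  have hpos : ∀ᵐ p ∂ν, 0 < p.2 := toν zmu_pos
  let Z : ℕ → ℕ → ℝ × ℝ → Fin (m+2) → ℝ := fun n j p i =>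
    zavg (fun y => W (φ n) y p.2 i) ((1/2)^j) p.1
  have hZm : ∀ n j, Measurable (Z n j) := fun n j =>
    measurable_pi_iff.2 fun i => zavg_meas2 (w := fun p => W (φ n) p.1 p.2 i) (h.meas _ i) _
  have hWm : ∀ n, Measurable fun p : ℝ × ℝ => W n p.1 p.2 := fun n => measurable_pi_iff.2 (h.meas n)
  have hd : ∀ j : ℕ, (0:ℝ) < (1/2)^j := fun j => by positivity
  have hZb : ∀ n j, ∀ᵐ p ∂ν, onenorm (Z n j p) ≤ M := fun n j => by
    filter_upwards [hGν] with p hp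
    exact zavg_onenorm (h.tv _ _ hp) (h.slice _ _) (hd j) (h.bd _ _ hp) _
  have hAb' : ∀ j, ∀ᵐ p ∂ν, onenorm (A j p.1 p.2) ≤ M := fun j => by
    filter_upwards [hpos] with p hp using hAb j _ _ hp
  have hUb' : ∀ᵐ p ∂ν, onenorm (Us p.1 p.2) ≤ M := by
    filter_upwards [hpos] with p hp using hUb _ _ hp
  have hbd : ∀ {F H : ℝ × ℝ → Fin (m+2) → ℝ}, (∀ᵐ p ∂ν, onenorm (F p) ≤ M) →
      (∀ᵐ p ∂ν, onenorm (H p) ≤ M) → ∀ᵐ p ∂ν, ‖onenorm (F p - H p)‖ ≤ 2 * M := by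
    intro F H h1 h2
    filter_upwards [h1, h2] with p h1 h2
    rw [Real.norm_eq_abs, abs_of_nonneg (onenorm_nonneg _)]
    linarith [onenorm_sub_le (F p) (H p)]
  have hmm : ∀ {F H : ℝ × ℝ → Fin (m+2) → ℝ}, Measurable F → Measurable H →
      Measurable fun p => onenorm (F p - H p) := fun h1 h2 =>
    onenorm_cont.measurable.comp (h1.sub h2)
  have hint : ∀ {F H : ℝ × ℝ → Fin (m+2) → ℝ}, Measurable F → Measurable H →
      (∀ᵐ p ∂ν, onenorm (F p) ≤ M) →
      (∀ᵐ p ∂ν, onenorm (H p) ≤ M) → Integrable (fun p => onenorm (F p - H p)) ν :=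
    fun h1 h2 h3 h4 => Integrable.of_bound (hmm h1 h2).aestronglyMeasurable _ (hbd h3 h4)
  -- first term
  have t1 : ∀ n j, ∫ p, onenorm (W (φ n) p.1 p.2 - Z n j p) ∂ν ≤ (m + 2 : ℕ) * ((1/2)^j * M) * R := by
    intro n j
    have hm1 : Measurable fun p : ℝ × ℝ =>
        ENNReal.ofReal (onenorm (W (φ n) p.1 p.2 - Z n j p)) :=
      ENNReal.measurable_ofReal.comp (hmm (hWm _) (hZm n j))
    rw [integral_eq_lintegral_of_nonneg_ae (Eventually.of_forall fun p => onenorm_nonneg _)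
      (hmm (hWm _) (hZm n j)).aestronglyMeasurable]
    have hMj : 0 ≤ (1/2)^j * M := mul_nonneg (hd j).le h.hM
    refine ENNReal.toReal_le_of_le_ofReal (by positivity) ?_
    have hν2 : ν = (volume.restrict (Set.Icc (-R) R)).prod (volume.restrict (Set.Ioc 0 R)) := by
      rw [hν]; unfold zmu
      rw [← Measure.prod_restrict, Measure.restrict_restrict measurableSet_Ioc,
        Set.inter_eq_left.2 (fun x hx => hx.1)]
    rw [hν2, lintegral_prod_symm _ hm1.aemeasurable]
    have hsl : ∀ᵐ t ∂(volume.restrict (Set.Ioc (0:ℝ) R)),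
        ∫⁻ x in Set.Icc (-R) R, ENNReal.ofReal (onenorm (W (φ n) x t - Z n j (x, t))) ≤
        ENNReal.ofReal ((m + 2 : ℕ) * ((1/2)^j * M)) := by
      rw [ae_restrict_iff' measurableSet_Ioc]
      filter_upwards [h.conull] with t ht ht0
      have htG := ht ht0.1
      refine (setLIntegral_le_lintegral _ _).trans ?_
      simp only [onenorm_ofReal]
      rw [lintegral_finsetSum]
      · refine (Finset.sum_le_sum fun i _ => zavg_close (zr_comp (h.tv (φ n) t htG) i)
          (h.slice _ t i) (hd j).le).trans ?_
        rw [Finset.sum_const, Finset.card_univ, Fintype.card_fin, nsmul_eq_mul,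
          ENNReal.ofReal_mul (Nat.cast_nonneg _), ENNReal.ofReal_natCast]
      · intro i _
        exact ENNReal.measurable_ofReal.comp
            (((h.slice _ t i).sub (zavg_meas (h.slice _ t i) _)).abs)
    refine (lintegral_mono_ae hsl).trans ?_
    rw [lintegral_const, Measure.restrict_apply_univ, Real.volume_Ioc, sub_zero,
      ← ENNReal.ofReal_mul (by positivity)]
  have t2 : ∀ j, Tendsto (fun n => ∫ p, onenorm (Z n j p - A j p.1 p.2) ∂ν) atTop (nhds 0) := by
    intro j
    have := tendsto_integral_of_dominated_convergence (μ := ν)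
      (F := fun n p => onenorm (Z n j p - A j p.1 p.2)) (f := fun _ => 0) (fun _ => 2 * M)
      (fun n => (hmm (hZm n j) (hAc j).measurable).aestronglyMeasurable) (integrable_const _)
      (fun n => hbd (hZb n j) (hAb' j)) (by
        filter_upwards [hGν] with p hp
        have := (onenorm_cont.tendsto _).comp ((hA j p.1 p.2 hp).sub_const (A j p.1 p.2))
        rw [sub_self, onenorm_zero] at this
        exact this)
    simpa using this
  have t3 : Tendsto (fun j => ∫ p, onenorm (A j p.1 p.2 - Us p.1 p.2) ∂ν) atTop (nhds 0) := by
    have := tendsto_integral_of_dominated_convergence (μ := ν)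
      (F := fun j p => onenorm (A j p.1 p.2 - Us p.1 p.2)) (f := fun _ => 0) (fun _ => 2 * M)
      (fun j => (hmm (hAc j).measurable hUm).aestronglyMeasurable) (integrable_const _)
      (fun j => hbd (hAb' j) hUb') (by
        filter_upwards [hpos] with p hp
        have := (onenorm_cont.tendsto _).comp ((hUs p.1 p.2 hp).sub_const (Us p.1 p.2))
        rw [sub_self, onenorm_zero] at this
        exact this)
    simpa using this
  have t1' : Tendsto (fun j : ℕ => (m + 2 : ℕ) * ((1/2:ℝ)^j * M) * R) atTop (nhds 0) := by
    have := ((tendsto_pow_atTop_nhds_zero_of_lt_one (r := (1/2:ℝ)) (by norm_num)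
      (by norm_num)).mul_const M).const_mul ((m+2 : ℕ):ℝ) |>.mul_const R
    simpa using this
  have key : ∀ n j, ∫ p, onenorm (W (φ n) p.1 p.2 - Us p.1 p.2) ∂ν ≤
      (m + 2 : ℕ) * ((1/2)^j * M) * R + ∫ p, onenorm (Z n j p - A j p.1 p.2) ∂ν
        + ∫ p, onenorm (A j p.1 p.2 - Us p.1 p.2) ∂ν := by
    intro n j
    have i1 := hint (hWm (φ n)) (hZm n j) (toν (hb _)) (hZb n j)
    have i2 := hint (hZm n j) (hAc j).measurable (hZb n j) (hAb' j)
    have i3 := hint (hAc j).measurable hUm (hAb' j) hUb'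
    have i12 : Integrable (fun p => onenorm (W (φ n) p.1 p.2 - Z n j p) +
      onenorm (Z n j p - A j p.1 p.2)) ν := i1.add i2
    refine le_trans ?_ (add_le_add_left (add_le_add_left (t1 n j) _) _)
    rw [← integral_add i1 i2, ← integral_add i12 i3]
    refine integral_mono (hint (hWm (φ n)) hUm (toν (hb _)) hUb') (i12.add i3) fun p => ?_
    have e : W (φ n) p.1 p.2 - Us p.1 p.2 = (W (φ n) p.1 p.2 - Z n j p) + (Z n j p - A j p.1 p.2)
      + (A j p.1 p.2 - Us p.1 p.2) := by abel
    simp only [Pi.add_apply]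
    rw [e]
    exact (onenorm_tri _ _).trans (add_le_add_left (onenorm_tri _ _) _)
  rw [Metric.tendsto_atTop]
  intro e he
  obtain ⟨j, hj1, hj2⟩ := ((t1'.eventually (gt_mem_nhds (show 0 < e/3 by positivity))).and
    (t3.eventually (gt_mem_nhds (show 0 < e/3 by positivity)))).exists
  obtain ⟨N, hN⟩ := eventually_atTop.1 ((t2 j).eventually (gt_mem_nhds (show 0 < e/3 by positivity)))
  refine ⟨N, fun n hn => ?_⟩
  rw [Real.dist_eq, sub_zero, abs_of_nonneg (integral_nonneg fun p => onenorm_nonneg _)]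
  have := key n j
  have := hN n hn
  linarith


open MeasureTheory Filter

theorem zr_weak2d {u q φ : ℝ × ℝ → ℝ} {B l e : ℝ} (hum : Measurable u) (hqm : Measurable q)
    (hub : ∀ᵐ p ∂zmu, |u p| ≤ B) (hqb : ∀ᵐ p ∂zmu, |q p| ≤ B)
    (h1 : ContDiff ℝ 1 φ) (h2 : HasCompactSupport φ) :
    (∫ t in Set.Ioi (0 : ℝ), ∫ x : ℝ, (u (x, t) * fderiv ℝ φ (x, t) (0, 1)
          + l * u (x, t) * fderiv ℝ φ (x, t) (1, 0) + e * q (x, t) * φ (x, t)))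
      = (∫ p, u p * fderiv ℝ φ p (0, 1) ∂zmu) + l * (∫ p, u p * fderiv ℝ φ p (1, 0) ∂zmu)
        + e * ∫ p, q p * φ p ∂zmu := by
  have i1 : Integrable (fun p => u p * fderiv ℝ φ p (0, 1)) zmu :=
    zmu_int hum hub (zr_cont_dir h1 _) (zr_supp_dir h2 _)
  have i2 : Integrable (fun p => u p * fderiv ℝ φ p (1, 0)) zmu :=
    zmu_int hum hub (zr_cont_dir h1 _) (zr_supp_dir h2 _)
  have i3 : Integrable (fun p => q p * φ p) zmu := zmu_int hqm hqb h1.continuous h2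
  have i6 : Integrable (fun p => u p * fderiv ℝ φ p (0, 1)
    + l * (u p * fderiv ℝ φ p (1, 0))) zmu := i1.add (i2.const_mul l)
  have i7 : Integrable (fun p => u p * fderiv ℝ φ p (0, 1)
    + l * (u p * fderiv ℝ φ p (1, 0)) + e * (q p * φ p)) zmu := i6.add (i3.const_mul e)
  have := zmu_iter i7
  rw [integral_add i6 (i3.const_mul _), integral_add i1 (i2.const_mul l), integral_const_mul,
    integral_const_mul] at this
  rw [← this]
  congr 1; ext t; congr 1; ext x; ring

theorem zr_pass {m : ℕ} {W : ℕ → ℝ × ℝ → Fin (m+2) → ℝ} {Us : ℝ × ℝ → Fin (m+2) → ℝ} {M K : ℝ}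
    (hWm : ∀ n, Measurable (W n)) (hUm : Measurable Us)
    (hWb : ∀ n, ∀ᵐ p ∂zmu, onenorm (W n p) ≤ M) (hUb : ∀ᵐ p ∂zmu, onenorm (Us p) ≤ M)
    (hc : ∀ R, 0 ≤ R → Tendsto (fun n => ∫ p in Set.Icc (-R) R ×ˢ Set.Ioc 0 R,
        onenorm (W n p - Us p) ∂zmu) atTop (nhds 0))
    {g : (Fin (m+2) → ℝ) → ℝ} (hg : Continuous g) (hK : 0 ≤ K)
    (hgl : ∀ V V', onenorm V ≤ M → onenorm V' ≤ M → |g V - g V'| ≤ K * onenorm (V - V'))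
    {b : ℝ × ℝ → ℝ} (hb : Continuous b) (hbs : HasCompactSupport b) :
    Tendsto (fun n => ∫ p, g (W n p) * b p ∂zmu) atTop (nhds (∫ p, g (Us p) * b p ∂zmu)) := by
  obtain ⟨R', hR'⟩ := hbs.isCompact.isBounded.subset_closedBall 0
  let R := max R' 0
  obtain ⟨S, hS⟩ := hb.bounded_above_of_compact_support hbs
  have hS0 : 0 ≤ S := (norm_nonneg _).trans (hS 0)
  have hgb : ∀ {F : ℝ × ℝ → Fin (m+2) → ℝ}, (∀ᵐ p ∂zmu, onenorm (F p) ≤ M) →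
      ∀ᵐ p ∂zmu, |g (F p)| ≤ |g 0| + K * M := by
    intro F hF
    filter_upwards [hF] with p hp
    have h1 := hgl (F p) 0 hp (by rw [onenorm_zero]; exact (onenorm_nonneg _).trans hp)
    rw [sub_zero] at h1
    have h2 := abs_sub_abs_le_abs_sub (g (F p)) (g 0)
    have h3 := mul_le_mul_of_nonneg_left hp hK
    linarith
  have hint : ∀ {F : ℝ × ℝ → Fin (m+2) → ℝ}, Measurable F → (∀ᵐ p ∂zmu, onenorm (F p) ≤ M) →
      Integrable (fun p => g (F p) * b p) zmu := fun h1 h2 =>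
    zmu_int (hg.measurable.comp h1) (hgb h2) hb hbs
  have hbox : ∀ n, IntegrableOn (fun p => onenorm (W n p - Us p))
      (Set.Icc (-R) R ×ˢ Set.Ioc 0 R) zmu := by
    intro n
    refine Measure.integrableOn_of_bounded (M := 2 * M) (zmu_box_lt_top R).ne
      (onenorm_cont.measurable.comp ((hWm n).sub hUm)).aestronglyMeasurable (ae_restrict_of_ae ?_)
    filter_upwards [hWb n, hUb] with p h1 h2
    rw [Real.norm_eq_abs, abs_of_nonneg (onenorm_nonneg _)]
    linarith [onenorm_sub_le (W n p) (Us p)]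
  rw [tendsto_iff_norm_sub_tendsto_zero]
  have hlim := (hc R (le_max_right _ _)).const_mul (S * K)
  rw [mul_zero] at hlim
  refine squeeze_zero (fun n => norm_nonneg _) (fun n => ?_) hlim
  rw [← integral_sub (hint (hWm n) (hWb n)) (hint hUm hUb), ← integral_const_mul,
    ← integral_indicator (measurableSet_Icc.prod measurableSet_Ioc)]
  refine norm_integral_le_of_norm_le ((integrable_indicator_iff
    (measurableSet_Icc.prod measurableSet_Ioc)).2 ((hbox n).const_mul _)) ?_
  filter_upwards [zmu_pos, hWb n, hUb] with p hp h1 h2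
  by_cases hm : p ∈ Set.Icc (-R) R ×ˢ Set.Ioc 0 R
  · rw [Set.indicator_of_mem hm, ← sub_mul, norm_mul, mul_comm, mul_assoc]
    exact mul_le_mul (hS p) (hgl _ _ h1 h2) (abs_nonneg _) hS0
  · have : b p = 0 := by
      by_contra h0
      have h3 := hR' (subset_tsupport _ h0)
      rw [mem_closedBall_zero_iff] at h3
      have h4 : ‖p‖ ≤ R := h3.trans (le_max_left _ _)
      exact hm ⟨abs_le.1 ((norm_fst_le p).trans h4), hp,
        (le_abs_self _).trans ((norm_snd_le p).trans h4)⟩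
    rw [Set.indicator_of_notMem hm, this]; simp


open MeasureTheory Filter

/-- **zero relaxation limit.** Suppose the initial data `U₀` is bounded,
measurable, of bounded total variation, vanishes for `x > 1`, and is in equilibrium
(`f_i(u_{i0}, u_{i+1,0}) = 0` a.e.); assume assumption (3) and Assumption (★).  For each
`ε > 0` let `U^ε` be a (measurable, bounded) weak solution of
`∂_t u_i + λ_i ∂_x u_i = (1/ε) Q_i(U)` with initial data `U₀` satisfying the uniform
bounds `|U^ε| ≤ TV(U₀)` a.e., `TV(U^ε(·,t)) ≤ TV(U₀)`, and
`∫ |U^ε(·,t) - U^ε(·,t₁)| ≤ C |t - t₁|` with `C` independent of `ε`.  Then there are a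
sequence `ε_k → 0`, `ε_k > 0`, and a bounded measurable `U*` with
`U^{ε_k} → U*` in `L¹_loc(ℝ × (0,∞))`, such that `U*` is a weak entropy solution of the
equilibrium system: `f_i(u_i*, u_{i+1}*) = 0` a.e. and the scalar conservation law
`∂_t (∑ u_i*) + ∂_x (∑ λ_i u_i*) = 0` holds weakly with initial data `∑ u_{i0}`; moreover
`|U*| ≤ TV(U₀)` a.e., `TV(U*(·,t)) ≤ TV(U₀)` and
`∫ |U*(·,t) - U*(·,t₁)| ≤ C |t - t₁|`. -/
theorem stmt19 (m : ℕ) (f : Fin (m + 1) → ℝ → ℝ → ℝ)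
    (hf1 : ∀ i, ContDiff ℝ 1 fun p : ℝ × ℝ => f i p.1 p.2)
    (hf2 : ∀ i w, StrictAnti fun v => f i v w)
    (hf3 : ∀ i v, StrictMono fun w => f i v w)
    (hf0 : ∀ i, f i 0 0 = 0)
    (hsign : ∀ v : ℝ, ∃ w : ℝ, ∀ i, 0 ≤ v * f i v w)
    (lam : Fin (m + 2) → ℝ)
    (N : (Fin (m + 1) → ℝ) → ℝ) (lam0 : ℝ)
    (hstar : StarAssumption m f N lam0)
    (U₀ : ℝ → Fin (m + 2) → ℝ)
    (hU₀m : ∀ i, Measurable fun x => U₀ x i)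
    (hU₀b : ∃ Cb : ℝ, ∀ x, onenorm (U₀ x) ≤ Cb)
    (hU₀tv : BddAbove (tvSet m U₀))
    (hU₀v : ∀ x > (1 : ℝ), U₀ x = 0)
    -- the initial data are in equilibrium
    (hU₀eq : ∀ i : Fin (m + 1), ∀ᵐ x : ℝ, f i (U₀ x i.castSucc) (U₀ x i.succ) = 0)
    -- the family of weak solutions U^ε, ε > 0
    (Uε : ℝ → ℝ → ℝ → Fin (m + 2) → ℝ)
    (hUεm : ∀ ε : ℝ, 0 < ε → ∀ i, Measurable fun p : ℝ × ℝ => Uε ε p.1 p.2 i)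
    (hUεbd : ∀ ε : ℝ, 0 < ε →
      ∀ᵐ p : ℝ × ℝ, 0 < p.2 → onenorm (Uε ε p.1 p.2) ≤ sSup (tvSet m U₀))
    (hUεweak : ∀ ε : ℝ, 0 < ε →
      ∀ φ : ℝ × ℝ → ℝ, ContDiff ℝ 1 φ → HasCompactSupport φ →
        ∀ i : Fin (m + 2),
          (∫ t in Set.Ioi (0 : ℝ), ∫ x : ℝ,
              (Uε ε x t i * fderiv ℝ φ (x, t) (0, 1)
                + lam i * Uε ε x t i * fderiv ℝ φ (x, t) (1, 0)
                + (1 / ε) * Qr m f (Uε ε x t) i * φ (x, t)))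
            + (∫ x : ℝ, U₀ x i * φ (x, 0)) = 0)
    (hUεtv : ∀ ε : ℝ, 0 < ε → ∀ t : ℝ, 0 < t →
      ∀ s ∈ tvSet m (fun x => Uε ε x t), s ≤ sSup (tvSet m U₀))
    (C : ℝ) (hC : 0 < C)
    (hUεlip : ∀ ε : ℝ, 0 < ε → ∀ t t₁ : ℝ, 0 < t → 0 < t₁ →
      (∫ x : ℝ, onenorm (Uε ε x t - Uε ε x t₁)) ≤ C * |t - t₁|) :
    ∃ (εk : ℕ → ℝ) (Ustar : ℝ → ℝ → Fin (m + 2) → ℝ),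
      (∀ k, 0 < εk k) ∧ Tendsto εk atTop (nhds 0) ∧
      -- U* is bounded and measurable
      (∀ i, Measurable fun p : ℝ × ℝ => Ustar p.1 p.2 i) ∧
      (∀ᵐ p : ℝ × ℝ, 0 < p.2 → onenorm (Ustar p.1 p.2) ≤ sSup (tvSet m U₀)) ∧
      -- convergence in L¹_loc(ℝ × (0,∞))
      (∀ a b c d : ℝ, 0 < c →
        Tendsto (fun k => ∫ t in Set.Ioc c d, ∫ x in Set.Ioc a b,
            onenorm (Uε (εk k) x t - Ustar x t)) atTop (nhds 0)) ∧
      -- U* takes values in equilibrium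
      (∀ i : Fin (m + 1),
        ∀ᵐ p : ℝ × ℝ, 0 < p.2 →
          f i (Ustar p.1 p.2 i.castSucc) (Ustar p.1 p.2 i.succ) = 0) ∧
      -- weak formulation of the equilibrium (reduced) conservation law
      (∀ φ : ℝ × ℝ → ℝ, ContDiff ℝ 1 φ → HasCompactSupport φ →
        (∫ t in Set.Ioi (0 : ℝ), ∫ x : ℝ,
            ((∑ i, Ustar x t i) * fderiv ℝ φ (x, t) (0, 1)
              + (∑ i, lam i * Ustar x t i) * fderiv ℝ φ (x, t) (1, 0)))
          + (∫ x : ℝ, (∑ i, U₀ x i) * φ (x, 0)) = 0) ∧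
      -- uniform bounds inherited by U*
      (∀ t : ℝ, 0 < t →
        ∀ s ∈ tvSet m (fun x => Ustar x t), s ≤ sSup (tvSet m U₀)) ∧
      (∀ t t₁ : ℝ, 0 < t → 0 < t₁ →
        (∫ x : ℝ, onenorm (Ustar x t - Ustar x t₁)) ≤ C * |t - t₁|) := by
  obtain ⟨Cb, hCb⟩ := hU₀b
  set M := sSup (tvSet m U₀) with hMdef
  have hM : 0 ≤ M := le_csSup hU₀tv ⟨0, fun _ => 0, monotone_const, by simp⟩
  let ε : ℕ → ℝ := fun n => 1 / ((n:ℝ) + 1)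
  have hε : ∀ n, 0 < ε n := fun n => by positivity
  have hεt : Tendsto ε atTop (nhds 0) := tendsto_one_div_add_atTop_nhds_zero_nat
  have hbμ : ∀ e, 0 < e → ∀ᵐ p ∂zmu, onenorm (Uε e p.1 p.2) ≤ M := fun e he => zmu_ae (hUεbd e he)
  let G : Set ℝ := {t | 0 < t ∧ ∀ n, (∫⁻ x, ENNReal.ofReal (onenorm (Uε (ε n) x t - U₀ x)) < ⊤) ∧
    ∀ᵐ x, onenorm (Uε (ε n) x t) ≤ M}
  have hUm' : ∀ e, 0 < e → Measurable fun p : ℝ × ℝ => Uε e p.1 p.2 := fun e he =>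
    measurable_pi_iff.2 (hUεm e he)
  have hUms : ∀ e t, 0 < e → Measurable fun x : ℝ => Uε e x t := fun e t he =>
    (hUm' e he).comp (f := fun x : ℝ => (x, t)) (by fun_prop)
  have hU₀m' : Measurable U₀ := measurable_pi_iff.2 hU₀m
  have hZ : ZH m (fun n => Uε (ε n)) M C G := by
    refine ⟨hM, hC, fun t ht => ht.1, ?_, fun n i => hUεm _ (hε n) i,
      fun n t ht => hUεtv _ (hε n) t ht.1, fun n t ht => (ht.2 n).2, ?_⟩
    · have h1 : ∀ n, ∀ᵐ t : ℝ, 0 < t →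
          ∫⁻ x, ENNReal.ofReal (onenorm (Uε (ε n) x t - U₀ x)) < ⊤ := fun n =>
        zr_slice hf1 lam hU₀m hCb hU₀eq hM (hε n) (hUεm _ (hε n)) (hUεbd _ (hε n))
          (hUεweak _ (hε n)) (hUεtv _ (hε n))
      have h2 : ∀ n, ∀ᵐ t : ℝ, 0 < t → ∀ᵐ x, onenorm (Uε (ε n) x t) ≤ M := fun n =>
        zmu_slice (hbμ _ (hε n))
      filter_upwards [ae_all_iff.2 h1, ae_all_iff.2 h2] with t ha hb ht
      exact ⟨ht, fun n => ⟨ha n ht, hb n ht⟩⟩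
    · intro n t ht t₁ ht₁
      have hm1 : Measurable fun x => onenorm (Uε (ε n) x t - Uε (ε n) x t₁) :=
        onenorm_cont.measurable.comp ((hUms _ t (hε n)).sub (hUms _ t₁ (hε n)))
      have hlt : ∫⁻ x, ENNReal.ofReal (onenorm (Uε (ε n) x t - Uε (ε n) x t₁)) < ⊤ := by
        refine lt_of_le_of_lt (lintegral_mono fun x => ?_) (lt_of_eq_of_lt
          (lintegral_add_left (μ := volume)
            (f := fun x => ENNReal.ofReal (onenorm (Uε (ε n) x t - U₀ x)))
            (ENNReal.measurable_ofReal.comp (onenorm_cont.measurable.comp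
              ((hUms _ t (hε n)).sub hU₀m')))
            (fun x => ENNReal.ofReal (onenorm (Uε (ε n) x t₁ - U₀ x))))
          (ENNReal.add_lt_top.2 ⟨(ht.2 n).1, (ht₁.2 n).1⟩))
        rw [← ENNReal.ofReal_add (onenorm_nonneg _) (onenorm_nonneg _)]
        refine ENNReal.ofReal_le_ofReal ?_
        have e : Uε (ε n) x t - Uε (ε n) x t₁ = (Uε (ε n) x t - U₀ x) - (Uε (ε n) x t₁ - U₀ x) := by
          abel
        rw [e]; exact onenorm_sub_le _ _
      have hi : Integrable fun x => onenorm (Uε (ε n) x t - Uε (ε n) x t₁) := by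
        refine ⟨hm1.aestronglyMeasurable, ?_⟩
        rw [hasFiniteIntegral_iff_ofReal (Eventually.of_forall fun x => onenorm_nonneg _)]
        exact hlt
      rw [← ofReal_integral_eq_lintegral_ofReal hi (Eventually.of_forall fun x => onenorm_nonneg _)]
      exact ENNReal.ofReal_le_ofReal (hUεlip _ (hε n) t t₁ ht.1 ht₁.1)
  obtain ⟨ψ, Us, hψ, hUsm, hUsb, hUstv, hUsl, hconv⟩ := hZ.conv (fun n => hbμ _ (hε n))
  have hUsbμ : ∀ᵐ p ∂zmu, onenorm (Us p.1 p.2) ≤ M := by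
    filter_upwards [zmu_pos] with p hp using hUsb _ _ hp
  have hUsmi : ∀ i, Measurable fun p : ℝ × ℝ => Us p.1 p.2 i := fun i =>
    (measurable_pi_apply i).comp hUsm
  have hε' : ∀ n, 0 < ε (ψ n) := fun n => hε _
  -- limit passages
  obtain ⟨K, hK, hKl⟩ := Qr_lip hf1 M
  have passU : ∀ (i : Fin (m+2)) {b : ℝ × ℝ → ℝ}, Continuous b → HasCompactSupport b →
      Tendsto (fun n => ∫ p, Uε (ε (ψ n)) p.1 p.2 i * b p ∂zmu) atTop
        (nhds (∫ p, Us p.1 p.2 i * b p ∂zmu)) := fun i b hb hbs =>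
    zr_pass (W := fun n p => Uε (ε (ψ n)) p.1 p.2) (Us := fun p => Us p.1 p.2) (M := M) (K := 1)
      (fun n => hUm' _ (hε' n)) hUsm (fun n => hbμ _ (hε' n)) hUsbμ hconv
      (g := fun V => V i) (continuous_apply i) zero_le_one
      (fun V V' _ _ => by rw [one_mul]; exact abs_le_onenorm (V - V') i) hb hbs
  have passQ : ∀ (i : Fin (m+2)) {b : ℝ × ℝ → ℝ}, Continuous b → HasCompactSupport b →
      Tendsto (fun n => ∫ p, Qr m f (Uε (ε (ψ n)) p.1 p.2) i * b p ∂zmu) atTop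
        (nhds (∫ p, Qr m f (Us p.1 p.2) i * b p ∂zmu)) := fun i b hb hbs =>
    zr_pass (W := fun n p => Uε (ε (ψ n)) p.1 p.2) (Us := fun p => Us p.1 p.2) (M := M) (K := K)
      (fun n => hUm' _ (hε' n)) hUsm (fun n => hbμ _ (hε' n)) hUsbμ hconv
      (g := fun V => Qr m f V i) ((continuous_apply i).comp (Qr_contDiff hf1).continuous) hK
      (fun V V' hV hV' => hKl V V' hV hV' i) hb hbs
  have hQb : ∀ {F : ℝ × ℝ → Fin (m+2) → ℝ}, (∀ᵐ p ∂zmu, onenorm (F p) ≤ M) → ∀ i,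
      ∀ᵐ p ∂zmu, |Qr m f (F p) i| ≤ K * M := by
    intro F hF i
    filter_upwards [hF] with p hp
    have h1 := hKl (F p) 0 hp (by rw [onenorm_zero]; exact hM) i
    rw [Qr_of_eq (V := 0) (fun i => hf0 i), sub_zero, sub_zero] at h1
    exact h1.trans (mul_le_mul_of_nonneg_left hp hK)
  have hQm : ∀ {F : ℝ × ℝ → Fin (m+2) → ℝ}, Measurable F → ∀ i,
      Measurable fun p => Qr m f (F p) i := fun hF i =>
    (measurable_pi_apply i).comp ((Qr_contDiff hf1).continuous.measurable.comp hF)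
  have hKM : 0 ≤ K * M := mul_nonneg hK hM
  have weak2 : ∀ n (φ : ℝ × ℝ → ℝ), ContDiff ℝ 1 φ → HasCompactSupport φ → ∀ i,
      (∫ p, Uε (ε (ψ n)) p.1 p.2 i * fderiv ℝ φ p (0, 1) ∂zmu)
      + lam i * (∫ p, Uε (ε (ψ n)) p.1 p.2 i * fderiv ℝ φ p (1, 0) ∂zmu)
      + 1 / ε (ψ n) * (∫ p, Qr m f (Uε (ε (ψ n)) p.1 p.2) i * φ p ∂zmu)
      + (∫ x : ℝ, U₀ x i * φ (x, 0)) = 0 := by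
    intro n φ h1 h2 i
    refine Eq.trans ?_ (hUεweak _ (hε' n) φ h1 h2 i)
    congr 1
    refine (zr_weak2d (u := fun p => Uε (ε (ψ n)) p.1 p.2 i)
      (q := fun p => Qr m f (Uε (ε (ψ n)) p.1 p.2) i) (B := M + K * M) (hUεm _ (hε' n) i)
      (hQm (hUm' _ (hε' n)) i) ?_ ?_ h1 h2).symm
    · filter_upwards [hbμ _ (hε' n)] with p hp
      exact (abs_le_onenorm _ i).trans (by linarith)
    · filter_upwards [hQb (hbμ _ (hε' n)) i] with p hp
      linarith
  refine ⟨fun n => ε (ψ n), Us, hε', hεt.comp hψ.tendsto_atTop, hUsmi,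
    Eventually.of_forall fun p hp => hUsb _ _ hp, ?_, ?_, ?_, hUstv, ?_⟩
  · intro a b c d hc
    let R := |a| + |b| + |d|
    have hR : 0 ≤ R := by positivity
    refine squeeze_zero (fun n => integral_nonneg fun t => integral_nonneg fun x =>
      onenorm_nonneg _) (fun n => ?_) (hconv R hR)
    have hbox : IntegrableOn (fun p : ℝ × ℝ => onenorm (Uε (ε (ψ n)) p.1 p.2 - Us p.1 p.2))
        (Set.Icc (-R) R ×ˢ Set.Ioc 0 R) zmu := by
      refine Measure.integrableOn_of_bounded (M := 2 * M) (zmu_box_lt_top R).ne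
        (onenorm_cont.measurable.comp ((hUm' _ (hε' n)).sub hUsm)).aestronglyMeasurable
        (ae_restrict_of_ae ?_)
      filter_upwards [hbμ _ (hε' n), hUsbμ] with p h1 h2
      rw [Real.norm_eq_abs, abs_of_nonneg (onenorm_nonneg _)]
      linarith [onenorm_sub_le (Uε (ε (ψ n)) p.1 p.2) (Us p.1 p.2)]
    have hsub : Set.Ioc a b ×ˢ Set.Ioc c d ⊆ Set.Icc (-R) R ×ˢ Set.Ioc 0 R := by
      rintro ⟨x, t⟩ ⟨hx, ht⟩
      have h1 := neg_abs_le a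
      have h2 := le_abs_self b
      have h3 := le_abs_self d
      have := abs_nonneg a
      have := abs_nonneg b
      have := abs_nonneg d
      have := hx.1
      have := hx.2
      have := ht.1
      have := ht.2
      simp only at *
      refine ⟨⟨?_, ?_⟩, ⟨?_, ?_⟩⟩ <;> simp only [R] <;> linarith
    have hν2 : zmu.restrict (Set.Ioc a b ×ˢ Set.Ioc c d) =
        (volume.restrict (Set.Ioc a b)).prod (volume.restrict (Set.Ioc c d)) := by
      unfold zmu
      rw [← Measure.prod_restrict, Measure.restrict_restrict measurableSet_Ioc,
        Set.inter_eq_left.2 (show Set.Ioc c d ⊆ Set.Ioi 0 from fun x hx => hc.trans hx.1)]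
    have hi2 := hbox.mono_set hsub
    refine le_trans (le_of_eq ?_) (setIntegral_mono_set hbox
      (Eventually.of_forall fun p => onenorm_nonneg _) hsub.eventuallyLE)
    unfold IntegrableOn at hi2
    rw [hν2] at hi2 ⊢
    rw [integral_prod_symm _ hi2]
  · have hz : ∀ i, ∀ᵐ p ∂zmu, Qr m f (Us p.1 p.2) i = 0 := by
      intro i
      refine ae_eq_zero_of_integral_contDiff_smul_eq_zero
        (zr_locInt (hQm hUsm i).aestronglyMeasurable (hQb hUsbμ i)) fun g hg hgs => ?_
      have hg1 : ContDiff ℝ 1 g := hg.of_le (by exact_mod_cast le_top)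
      have l1 := passQ i hg1.continuous hgs
      have l2 : Tendsto (fun n => ∫ p, Qr m f (Uε (ε (ψ n)) p.1 p.2) i * g p ∂zmu) atTop (nhds 0) := by
        have l3 := ((passU i (zr_cont_dir hg1 (0, 1)) (zr_supp_dir hgs _)).add
          ((passU i (zr_cont_dir hg1 (1, 0)) (zr_supp_dir hgs _)).const_mul (lam i))).add_const
            (∫ x : ℝ, U₀ x i * g (x, 0))
        have l4 := ((hεt.comp hψ.tendsto_atTop).mul l3).neg
        rw [zero_mul, neg_zero] at l4
        refine l4.congr fun n => ?_
        have := weak2 n g hg1 hgs i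
        have hne := (hε' n).ne'
        simp only [Function.comp_apply]
        field_simp at this
        linarith
      have := tendsto_nhds_unique l1 l2
      simpa only [smul_eq_mul, mul_comm] using this
    intro i
    refine zmu_ae_vol ?_
    filter_upwards [ae_all_iff.2 hz] with p hp
    exact eq_of_Qr hp i
  · intro φ h1 h2
    have hl : Tendsto (fun n => ∑ i, ((∫ p, Uε (ε (ψ n)) p.1 p.2 i * fderiv ℝ φ p (0, 1) ∂zmu)
        + lam i * (∫ p, Uε (ε (ψ n)) p.1 p.2 i * fderiv ℝ φ p (1, 0) ∂zmu)
        + (∫ x : ℝ, U₀ x i * φ (x, 0)))) atTop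
        (nhds (∑ i, ((∫ p, Us p.1 p.2 i * fderiv ℝ φ p (0, 1) ∂zmu)
        + lam i * (∫ p, Us p.1 p.2 i * fderiv ℝ φ p (1, 0) ∂zmu)
        + (∫ x : ℝ, U₀ x i * φ (x, 0))))) :=
      tendsto_finsetSum _ fun i _ => ((passU i (zr_cont_dir h1 (0, 1)) (zr_supp_dir h2 _)).add
          ((passU i (zr_cont_dir h1 (1, 0)) (zr_supp_dir h2 _)).const_mul (lam i))).add_const _
    have hz : ∀ n, ∑ i, ((∫ p, Uε (ε (ψ n)) p.1 p.2 i * fderiv ℝ φ p (0, 1) ∂zmu)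
        + lam i * (∫ p, Uε (ε (ψ n)) p.1 p.2 i * fderiv ℝ φ p (1, 0) ∂zmu)
        + (∫ x : ℝ, U₀ x i * φ (x, 0))) = 0 := by
      intro n
      have hs : ∑ i, (∫ p, Qr m f (Uε (ε (ψ n)) p.1 p.2) i * φ p ∂zmu) = 0 := by
        rw [← integral_finsetSum _ fun i _ => zmu_int (hQm (hUm' _ (hε' n)) i)
          (hQb (hbμ _ (hε' n)) i) h1.continuous h2]
        simp only [← Finset.sum_mul, Qr_sum, zero_mul, integral_zero]
      have hsum := Finset.sum_congr rfl fun i (_ : i ∈ Finset.univ) => weak2 n φ h1 h2 i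
      simp only [Finset.sum_add_distrib, ← Finset.mul_sum, Finset.sum_const_zero, hs, mul_zero,
        add_zero] at hsum ⊢
      exact hsum
    have hfin := tendsto_nhds_unique hl (by simp only [hz]; exact tendsto_const_nhds)
    have hub : ∀ i, ∀ᵐ p ∂zmu, |Us p.1 p.2 i| ≤ M := fun i =>
      hUsbμ.mono fun p hp => (abs_le_onenorm _ i).trans hp
    have i1 : ∀ i, Integrable (fun p => Us p.1 p.2 i * fderiv ℝ φ p (0, 1)) zmu := fun i =>
      zmu_int (hUsmi i) (hub i) (zr_cont_dir h1 _) (zr_supp_dir h2 _)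
    have i2 : ∀ i, Integrable (fun p => lam i * (Us p.1 p.2 i * fderiv ℝ φ p (1, 0))) zmu := fun i =>
      (zmu_int (hUsmi i) (hub i) (zr_cont_dir h1 _) (zr_supp_dir h2 _)).const_mul _
    have i3 : ∀ i, Integrable (fun x : ℝ => U₀ x i * φ (x, 0)) := fun i => by
      refine Integrable.bdd_mul (c := Cb) ?_ (hU₀m i).aestronglyMeasurable
        (Eventually.of_forall fun x => (abs_le_onenorm _ i).trans (hCb x))
      refine Continuous.integrable_of_hasCompactSupport (by have := h1.continuous; fun_prop) ?_
      obtain ⟨R, hR⟩ := h2.isCompact.isBounded.subset_closedBall 0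
      refine HasCompactSupport.intro (isCompact_Icc (a := -R) (b := R)) fun x hx => ?_
      by_contra hne
      refine hx (abs_le.1 ?_)
      have h3 := hR (subset_tsupport φ hne)
      rw [mem_closedBall_zero_iff] at h3
      exact (norm_fst_le (x, (0:ℝ))).trans h3
    have i4 : ∀ i, Integrable (fun p => Us p.1 p.2 i * fderiv ℝ φ p (0, 1)
        + lam i * (Us p.1 p.2 i * fderiv ℝ φ p (1, 0))) zmu := fun i => (i1 i).add (i2 i)
    have e1 := zmu_iter (integrable_finsetSum Finset.univ fun i _ => i4 i)
    rw [integral_finsetSum _ fun i _ => i4 i] at e1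
    simp only [integral_add (i1 _) (i2 _), integral_const_mul] at e1
    rw [Finset.sum_add_distrib, ← e1] at hfin
    rw [← integral_finsetSum _ fun i _ => i3 i] at hfin
    refine Eq.trans ?_ hfin
    congr 1
    · congr 1; ext t; congr 1; ext x
      simp only [Finset.sum_add_distrib, Finset.sum_mul]
      congr 1
      exact Finset.sum_congr rfl fun i _ => by ring
    · congr 1; ext x
      rw [Finset.sum_mul]
  · intro t t₁ ht ht₁
    have hm1 : ∀ t, Measurable fun x => Us x t := fun t =>
      hUsm.comp (f := fun x : ℝ => (x, t)) (by fun_prop)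
    have hmm : Measurable fun x => onenorm (Us x t - Us x t₁) :=
      onenorm_cont.measurable.comp ((hm1 t).sub (hm1 t₁))
    rw [integral_eq_lintegral_of_nonneg_ae (Eventually.of_forall fun p => onenorm_nonneg _)
      hmm.aestronglyMeasurable]
    exact ENNReal.toReal_le_of_le_ofReal (by positivity) (hUsl t t₁ ht ht₁)
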